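/- arXiv:2602.16067 — 3 statements merged into one kernel-verified Lean document; each statement's English description precedes it below -/
import Mathlib

section
/- Let L_t and L̃_t be two time-dependent Lindbladians on M_d(ℂ) (each of the form x ↦ −i[H(t), x] + Σ_j L_j(t) x L_j(t)† − (1/2){L_j(t)†L_j(t), x} with H(t) Hermitian, continuous in t). Suppose L_t is exponentially contractive with constants K, γ > 0, and define ΔL := sup_{t ≥ 0} |||L̃_t − L_t|||, where |||T||| := sup over nonzero x ∈ M_d(ℂ) of ‖T(x)‖₁/‖x‖₁. If ΔL < γ/(1 + ln K), then L̃_t is also exponentially contractive. Moreover, in the case K = 1, the constants for L̃_t can be taken to be K̃ = 1 and γ̃ = γ − ΔL. -/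
open scoped ComplexOrder Kronecker
open Matrix

namespace Paper

variable {n : Type*} [Fintype n] [DecidableEq n]

/-- Trace norm: sum of singular values. -/
noncomputable def traceNorm (A : Matrix n n ℂ) : ℝ :=
  ∑ i, Real.sqrt ((Matrix.posSemidef_conjTranspose_mul_self A).isHermitian.eigenvalues i)

/-- The dissipator associated with a single jump operator. -/
noncomputable def dissipator (L x : Matrix n n ℂ) : Matrix n n ℂ :=
  L * x * Lᴴ - ((1 : ℂ)/2) • (Lᴴ * L * x + x * (Lᴴ * L))

/-- Total dissipator of a family of jump operators. -/
noncomputable def totalDissipator {m : ℕ} (L : Fin m → Matrix n n ℂ) (x : Matrix n n ℂ) :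
    Matrix n n ℂ :=
  ∑ j, dissipator (L j) x

/-- The Hamiltonian commutator term `-i[H, x]`. -/
noncomputable def hamTerm (H x : Matrix n n ℂ) : Matrix n n ℂ :=
  (-Complex.I) • (H * x - x * H)

/-- A solution of the master equation `ρ' = L_t(ρ)` starting at time `s`
(differentiable entrywise). -/
def IsSolution (Lt : ℝ → Matrix n n ℂ → Matrix n n ℂ) (s : ℝ) (ρ : ℝ → Matrix n n ℂ) : Prop :=
  ∀ t, s ≤ t → ∀ i j, HasDerivAt (fun u => ρ u i j) ((Lt t (ρ t)) i j) t

/-- Density matrix: Hermitian, positive semidefinite, trace one. -/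
def IsDensity (ρ : Matrix n n ℂ) : Prop := ρ.PosSemidef ∧ ρ.trace = 1

/-- Exponential contractivity with constants `K, γ` of a time-dependent Lindbladian. -/
def ExpContractiveWith (Lt : ℝ → Matrix n n ℂ → Matrix n n ℂ) (K γ : ℝ) : Prop :=
  ∀ s t : ℝ, 0 ≤ s → s ≤ t → ∀ ρ σ : ℝ → Matrix n n ℂ,
    IsSolution Lt s ρ → IsSolution Lt s σ → IsDensity (ρ s) → IsDensity (σ s) →
    traceNorm (ρ t - σ t) ≤ K * Real.exp (-γ * (t - s)) * traceNorm (ρ s - σ s)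

/-- Exponential contractivity of a time-dependent Lindbladian. -/
def ExpContractive (Lt : ℝ → Matrix n n ℂ → Matrix n n ℂ) : Prop :=
  ∃ K γ : ℝ, 0 < K ∧ 0 < γ ∧ ExpContractiveWith Lt K γ

/-- Time-dependent Hamiltonian: Hermitian values and continuous entries. -/
def IsHamiltonianFamily (H : ℝ → Matrix n n ℂ) : Prop :=
  (∀ t, (H t).IsHermitian) ∧ ∀ i j, Continuous fun t => H t i j

/-- Driven Lindbladian `x ↦ -i[H(t), x] + D(x)`. -/
noncomputable def driven {m : ℕ} (H : ℝ → Matrix n n ℂ) (L : Fin m → Matrix n n ℂ)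
    (t : ℝ) (x : Matrix n n ℂ) : Matrix n n ℂ :=
  hamTerm (H t) x + totalDissipator L x

/-- Hamiltonian-independent contractivity of a dissipator. -/
def HamIndepContractive {m : ℕ} (L : Fin m → Matrix n n ℂ) : Prop :=
  ∀ H : ℝ → Matrix n n ℂ, IsHamiltonianFamily H → ExpContractive (driven H L)

/-- The operator norm (largest singular value). -/
noncomputable def opNorm (A : Matrix n n ℂ) : ℝ :=
  ‖LinearMap.toContinuousLinearMap (Matrix.toEuclideanLin A)‖

end Paper

namespace Paper

section Abstract

open Set Filter Topology

/-- Terms of the Dyson series. -/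
noncomputable def dyson {E : Type*} [NormedAddCommGroup E] [NormedSpace ℝ E]
    (M : ℝ → E →L[ℝ] E) (w : E) : ℕ → ℝ → E
  | 0 => fun _ => w
  | n + 1 => fun t => ∫ s in (0 : ℝ)..t, M s (dyson M w n s)

variable {E : Type*} [NormedAddCommGroup E] [NormedSpace ℝ E]

lemma dyson_continuous [CompleteSpace E] {M : ℝ → E →L[ℝ] E} (hM : Continuous M) (w : E) (n : ℕ) :
    Continuous (dyson M w n) := by
  induction n with
  | zero => exact continuous_const
  | succ n ih =>
    have h : Continuous fun s => M s (dyson M w n s) := hM.clm_apply ih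
    exact intervalIntegral.continuous_primitive (fun a b => h.intervalIntegrable a b) 0

lemma dyson_hasDerivAt [CompleteSpace E] {M : ℝ → E →L[ℝ] E} (hM : Continuous M) (w : E) (n : ℕ)
    (t : ℝ) : HasDerivAt (dyson M w (n + 1)) (M t (dyson M w n t)) t := by
  have h : Continuous fun s => M s (dyson M w n s) := hM.clm_apply (dyson_continuous hM w n)
  exact intervalIntegral.integral_hasDerivAt_right (h.intervalIntegrable _ _)
    (h.stronglyMeasurableAtFilter _ _) h.continuousAt

lemma dyson_bound [CompleteSpace E] {M : ℝ → E →L[ℝ] E} (hM : Continuous M) (w : E) {T C : ℝ}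
    (hC : ∀ t, |t| ≤ T → ‖M t‖ ≤ C) (hC0 : 0 ≤ C) (n : ℕ) :
    ∀ t, |t| ≤ T → ‖dyson M w n t‖ ≤ ‖w‖ * ((C * |t|) ^ n / n.factorial) := by
  induction n with
  | zero => intro t _; simp [dyson]
  | succ n ih =>
    intro t ht
    have hint : ∫ x in uIoc (0 : ℝ) t, |x| ^ n = |t| ^ (n + 1) / (n + 1) := by
      simpa using integral_pow_abs_sub_uIoc (a := 0) (b := t) n
    calc ‖dyson M w (n + 1) t‖ ≤ ∫ x in uIoc (0 : ℝ) t, ‖M x (dyson M w n x)‖ :=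
          intervalIntegral.norm_integral_le_integral_norm_uIoc
      _ ≤ ∫ x in uIoc (0 : ℝ) t, (C * ‖w‖ * (C ^ n / n.factorial)) * |x| ^ n := by
          apply MeasureTheory.setIntegral_mono_on
          · have h : Continuous fun s => ‖M s (dyson M w n s)‖ :=
              (hM.clm_apply (dyson_continuous hM w n)).norm
            exact (intervalIntegrable_iff.1 (h.intervalIntegrable 0 t))
          · have h : Continuous fun x : ℝ => (C * ‖w‖ * (C ^ n / n.factorial)) * |x| ^ n := by
              fun_prop
            exact (intervalIntegrable_iff.1 (h.intervalIntegrable 0 t))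
          · exact measurableSet_uIoc
          · intro x hx
            have hxT : |x| ≤ T := by
              have : |x| ≤ |t| := by
                rcases le_total 0 t with h | h
                · rw [uIoc_of_le h] at hx
                  rw [abs_of_pos hx.1, abs_of_nonneg h]; exact hx.2
                · rw [uIoc_of_ge h] at hx
                  rw [abs_of_nonpos hx.2, abs_of_nonpos h]; linarith [hx.1]
              exact this.trans ht
            calc ‖M x (dyson M w n x)‖ ≤ ‖M x‖ * ‖dyson M w n x‖ := (M x).le_opNorm _
              _ ≤ C * (‖w‖ * ((C * |x|) ^ n / n.factorial)) :=
                mul_le_mul (hC x hxT) (ih x hxT) (norm_nonneg _) hC0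
              _ = _ := by rw [mul_pow]; ring
      _ = ‖w‖ * ((C * |t|) ^ (n + 1) / (n + 1).factorial) := by
          rw [MeasureTheory.integral_const_mul, hint, Nat.factorial_succ, mul_pow]
          push_cast
          field_simp
          ring

/-- Global solvability of linear ODEs. -/
lemma linear_ode [CompleteSpace E] {M : ℝ → E →L[ℝ] E} (hM : Continuous M) (w : E) :
    ∃ W : ℝ → E, W 0 = w ∧ ∀ t, HasDerivAt W (M t (W t)) t := by
  refine ⟨fun t => ∑' n, dyson M w n t, ?_, ?_⟩
  · show ∑' n, dyson M w n 0 = w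
    rw [tsum_eq_single 0]
    · rfl
    · intro n hn
      obtain ⟨k, rfl⟩ := Nat.exists_eq_succ_of_ne_zero hn
      simp [dyson]
  · intro t
    set T := |t| + 1 with hT
    obtain ⟨C, hC⟩ : ∃ C, ∀ x ∈ Icc (-T) T, ‖M x‖ ≤ C :=
      isCompact_Icc.exists_bound_of_continuousOn hM.continuousOn
    have hC' : ∀ t, |t| ≤ T → ‖M t‖ ≤ C := fun t ht => hC t (abs_le.1 ht)
    have hC0 : 0 ≤ C := (norm_nonneg _).trans (hC' t (by linarith))
    have hb := dyson_bound hM w hC' hC0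
    have hT0 : 0 ≤ T := by positivity
    have hb' : ∀ n x, |x| ≤ T → ‖dyson M w n x‖ ≤ ‖w‖ * ((C * T) ^ n / n.factorial) := by
      intro n x hx
      refine (hb n x hx).trans ?_
      gcongr
    have hsumm : Summable fun n : ℕ => ‖w‖ * ((C * T) ^ n / n.factorial) :=
      (Real.summable_pow_div_factorial _).mul_left _
    have hs : ∀ x, |x| ≤ T → Summable fun n => dyson M w n x := fun x hx =>
      Summable.of_norm_bounded hsumm (fun n => hb' n x hx)
    have htT : t ∈ Ioo (-T) T := abs_lt.1 (by rw [hT]; linarith)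
    let g' : ℕ → ℝ → E := fun n x => match n with
      | 0 => 0
      | k + 1 => M x (dyson M w k x)
    let u : ℕ → ℝ := fun n => match n with
      | 0 => 0
      | k + 1 => C * (‖w‖ * ((C * T) ^ k / k.factorial))
    have hu : Summable u := by
      rw [← summable_nat_add_iff 1]
      exact hsumm.mul_left C
    have key := hasDerivAt_tsum_of_isPreconnected (g := dyson M w) (g' := g') (u := u) (y₀ := t)
      (y := t) (t := Ioo (-T) T) hu isOpen_Ioo isPreconnected_Ioo ?_ ?_ htT
      (hs t (abs_lt.2 htT).le) htT
    · convert key using 1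
      have hg : Summable fun n => g' n t := by
        rw [← summable_nat_add_iff 1]
        exact ((M t).summable (hs t (abs_lt.2 htT).le))
      rw [hg.tsum_eq_zero_add]
      simp only [g', zero_add]
      exact (M t).map_tsum (hs t (abs_lt.2 htT).le)
    · intro n y hy
      cases n with
      | zero => exact hasDerivAt_const _ _
      | succ k => exact dyson_hasDerivAt hM w k y
    · intro n y hy
      have hy' : |y| ≤ T := (abs_lt.2 hy).le
      cases n with
      | zero => simp [g', u]
      | succ k =>
        exact ((M y).le_opNorm _).trans (mul_le_mul (hC' y hy') (hb' k y hy') (norm_nonneg _) hC0)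

/-- Propagators. -/
lemma exists_propagator [FiniteDimensional ℝ E] {A : ℝ → E →L[ℝ] E} (hA : Continuous A) :
    ∃ U V : ℝ → E →L[ℝ] E, (∀ t, HasDerivAt U (A t * U t) t) ∧
      (∀ t, HasDerivAt V (-(V t * A t)) t) ∧ (∀ t, V t * U t = 1) ∧ (∀ t, U t * V t = 1) := by
  have : CompleteSpace E := FiniteDimensional.complete ℝ E
  obtain ⟨U, hU0, hU⟩ := linear_ode (E := E →L[ℝ] E)
    (M := fun t => ContinuousLinearMap.mul ℝ (E →L[ℝ] E) (A t)) (by fun_prop) 1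
  obtain ⟨V, hV0, hV⟩ := linear_ode (E := E →L[ℝ] E)
    (M := fun t => -((ContinuousLinearMap.mul ℝ (E →L[ℝ] E)).flip (A t))) (by fun_prop) 1
  have hU' : ∀ t, HasDerivAt U (A t * U t) t := fun t => by simpa using hU t
  have hV' : ∀ t, HasDerivAt V (-(V t * A t)) t := fun t => by simpa using hV t
  have hVU : ∀ t, V t * U t = 1 := by
    intro t
    have hd : ∀ x, HasDerivAt (fun t => V t * U t) 0 x := by
      intro x
      have := (hV' x).mul (hU' x)
      have h0 : -(V x * A x) * U x + V x * (A x * U x) = 0 := by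
        rw [neg_mul, mul_assoc, neg_add_cancel]
      rw [h0] at this
      exact this
    have := is_const_of_deriv_eq_zero (fun x => (hd x).differentiableAt) (fun x => (hd x).deriv) t 0
    simpa [hU0, hV0] using this
  refine ⟨U, V, hU', hV', hVU, fun t => ?_⟩
  have h1 : ((V t : E →L[ℝ] E) : E →ₗ[ℝ] E) * ((U t : E →L[ℝ] E) : E →ₗ[ℝ] E) = 1 := by
    ext x
    exact congrArg (fun f : E →L[ℝ] E => f x) (hVU t)
  have h2 := mul_eq_one_comm.1 h1
  ext x
  exact congrArg (fun f : E →ₗ[ℝ] E => f x) h2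

lemma const_of_deriv_zero {f : ℝ → E} {s t : ℝ} (hst : s ≤ t)
    (h : ∀ u, s ≤ u → HasDerivAt f 0 u) : f t = f s :=
  constant_of_has_deriv_right_zero
    (fun u hu => (h u hu.1).continuousAt.continuousWithinAt)
    (fun u hu => (h u hu.1).hasDerivWithinAt) t ⟨hst, le_rfl⟩

/-- norm is nonincreasing along dissipative evolutions. -/
lemma norm_antitone {A : ℝ → E →L[ℝ] E}
    (hD : ∀ t x, ∃ C, ∀ h : ℝ, 0 ≤ h → ‖x + h • A t x‖ ≤ ‖x‖ + C * h ^ 2)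
    {y : ℝ → E} {s t : ℝ} (hst : s ≤ t) (hy : ∀ u, s ≤ u → HasDerivAt y (A u (y u)) u) :
    ‖y t‖ ≤ ‖y s‖ := by
  have hc : ContinuousOn (fun u => ‖y u‖) (Icc s t) :=
    fun u hu => (hy u hu.1).continuousAt.continuousWithinAt.norm
  refine image_le_of_liminf_slope_right_le_deriv_boundary (B := fun _ => ‖y s‖) (B' := fun _ => 0)
    hc le_rfl continuousOn_const (fun x _ => hasDerivWithinAt_const _ _ _) ?_ ⟨hst, le_rfl⟩
  intro x hx r hr
  apply Eventually.frequently
  obtain ⟨C, hC⟩ := hD x (y x)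
  have hlo := (hasDerivAt_iff_isLittleO.1 (hy x hx.1)).def (half_pos hr)
  have h1 : ∀ᶠ z in 𝓝[>] x, ‖y z - y x - (z - x) • A x (y x)‖ ≤ r / 2 * ‖z - x‖ :=
    hlo.filter_mono nhdsWithin_le_nhds
  have h2 : ∀ᶠ z in 𝓝[>] x, C * (z - x) < r / 2 := by
    have : Tendsto (fun z => C * (z - x)) (𝓝 x) (𝓝 (C * (x - x))) := by
      apply Continuous.tendsto; fun_prop
    rw [sub_self, mul_zero] at this
    exact (this.eventually (gt_mem_nhds (half_pos hr))).filter_mono nhdsWithin_le_nhds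
  filter_upwards [h1, h2, self_mem_nhdsWithin] with z hz1 hz2 hz3
  have hz : 0 < z - x := sub_pos.2 hz3
  rw [slope_def_field, div_lt_iff₀ hz]
  rw [Real.norm_of_nonneg hz.le] at hz1
  have h3 := hC (z - x) hz.le
  have h4 : ‖y z‖ ≤ ‖y z - y x - (z - x) • A x (y x)‖ + ‖y x + (z - x) • A x (y x)‖ := by
    have := norm_add_le (y z - y x - (z - x) • A x (y x)) (y x + (z - x) • A x (y x))
    have e : y z - y x - (z - x) • A x (y x) + (y x + (z - x) • A x (y x)) = y z := by abel
    rwa [e] at this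
  nlinarith

lemma step_bound [FiniteDimensional ℝ E] {A B : ℝ → E →L[ℝ] E} (hA : Continuous A)
    (τ : E →L[ℝ] ℝ) (hτA : ∀ t x, τ (A t x) = 0) (hτB : ∀ t x, τ (B t x) = 0)
    (hDA : ∀ t x, ∃ C, ∀ h : ℝ, 0 ≤ h → ‖x + h • A t x‖ ≤ ‖x‖ + C * h ^ 2)
    (hDB : ∀ t x, ∃ C, ∀ h : ℝ, 0 ≤ h → ‖x + h • B t x‖ ≤ ‖x‖ + C * h ^ 2)
    {K γ ΔL : ℝ} (hK : 1 ≤ K) (hγ : 0 < γ) (hΔ0 : 0 ≤ ΔL)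
    (hc : ∀ s t, 0 ≤ s → s ≤ t → ∀ z : ℝ → E, (∀ u, HasDerivAt z (A u (z u)) u) → τ (z s) = 0 →
      ‖z t‖ ≤ K * Real.exp (-γ * (t - s)) * ‖z s‖)
    (hΔ : ∀ t, 0 ≤ t → ∀ x, ‖B t x - A t x‖ ≤ ΔL * ‖x‖)
    {s T : ℝ} (hs : 0 ≤ s) (hT : Real.log K / γ ≤ T)
    {y : ℝ → E} (hy : ∀ u, s ≤ u → HasDerivAt y (B u (y u)) u) (hy0 : τ (y s) = 0) :
    ‖y (s + T)‖ ≤ (K * Real.exp (-γ * T) + ΔL * (1 + Real.log K) / γ) * ‖y s‖ := by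
  obtain ⟨U, V, hU, hV, hVU, hUV⟩ := exists_propagator hA
  have hUV' : ∀ t x, U t (V t x) = x := fun t x =>
    congrArg (fun f : E →L[ℝ] E => f x) (hUV t)
  have hz : ∀ x r, HasDerivAt (fun r => U r x) (A r (U r x)) r := fun x r => by
    simpa using (hU r).clm_apply (hasDerivAt_const r x)
  have hP1 : ∀ u t, 0 ≤ u → u ≤ t → ∀ x, τ x = 0 →
      ‖U t (V u x)‖ ≤ K * Real.exp (-γ * (t - u)) * ‖x‖ := by
    intro u t hu hut x hx
    have := hc u t hu hut (fun r => U r (V u x)) (hz _) (by simpa [hUV'] using hx)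
    simpa [hUV'] using this
  have hP2 : ∀ u t, u ≤ t → ∀ x, ‖U t (V u x)‖ ≤ ‖x‖ := by
    intro u t hut x
    have := norm_antitone hDA hut (y := fun r => U r (V u x)) (fun r _ => hz _ r)
    simpa [hUV'] using this
  set T' := s + T with hT'
  set N := ‖y s‖ with hN
  have hN0 : 0 ≤ N := norm_nonneg _
  have hlog : 0 ≤ Real.log K := Real.log_nonneg hK
  have hq : 0 ≤ Real.log K / γ := by positivity
  have hyN : ∀ u, s ≤ u → ‖y u‖ ≤ N := fun u hu => norm_antitone hDB hu hy
  have hgd : ∀ u, s ≤ u → HasDerivAt (fun u => U T' (V u (y u)))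
      (U T' (V u (B u (y u) - A u (y u)))) u := by
    intro u hu
    have h1 := (hV u).clm_apply (hy u hu)
    have h2 := (hasDerivAt_const u (U T')).clm_apply h1
    convert h2 using 1
    simp [sub_eq_add_neg, add_comm]
  set g := fun u => U T' (V u (y u)) with hg
  have hgc : ∀ a b, s ≤ a → ContinuousOn g (Icc a b) := fun a b ha u hu =>
    (hgd u (ha.trans hu.1)).continuousAt.continuousWithinAt
  set m := T' - Real.log K / γ with hm
  have hsm : s ≤ m := by rw [hm, hT']; linarith
  have hmT : m ≤ T' := by rw [hm]; linarith
  have hKpos : 0 < K := by linarith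
  have hdiff : ∀ u, s ≤ u → ‖B u (y u) - A u (y u)‖ ≤ ΔL * N := fun u hu =>
    (hΔ u (hs.trans hu) _).trans (mul_le_mul_of_nonneg_left (hyN u hu) hΔ0)
  have hgs : ‖g s‖ ≤ K * Real.exp (-γ * T) * N := by
    have := hP1 s T' hs (hsm.trans hmT) (y s) hy0
    have e : T' - s = T := by rw [hT']; ring
    rwa [e] at this
  -- first piece
  have h1 : ‖g m‖ ≤ K * Real.exp (-γ * T) * N + ΔL * N / γ := by
    have := image_norm_le_of_norm_deriv_right_le_deriv_boundary (f := g) (a := s) (b := m)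
      (B := fun u => K * Real.exp (-γ * T) * N + ΔL * N / γ * (K * Real.exp (-γ * (T' - u))))
      (B' := fun u => K * Real.exp (-γ * (T' - u)) * (ΔL * N))
      (hgc s m le_rfl) (fun u hu => (hgd u hu.1).hasDerivWithinAt)
      (hgs.trans (le_add_of_nonneg_right (by positivity)))
      ?_ ?_ ⟨hsm, le_rfl⟩
    · have e : K * Real.exp (-γ * (T' - m)) = 1 := by
        have : -γ * (T' - m) = - Real.log K := by rw [hm]; field_simp; ring
        rw [this, Real.exp_neg, Real.exp_log hKpos]; field_simp
      simp only [e, mul_one] at this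
      exact this
    · intro u
      have hi : HasDerivAt (fun u => -γ * (T' - u)) (-γ * (-1)) u := by
        simpa using ((hasDerivAt_id u).const_sub T').const_mul (-γ)
      have := ((hi.exp.const_mul K).const_mul (ΔL * N / γ)).const_add (K * Real.exp (-γ * T) * N)
      have e : K * Real.exp (-γ * (T' - u)) * (ΔL * N) =
          ΔL * N / γ * (K * (Real.exp (-γ * (T' - u)) * (-γ * (-1)))) := by
        field_simp
      show HasDerivAt _ (K * Real.exp (-γ * (T' - u)) * (ΔL * N)) u
      rw [e]
      exact this
    · intro u hu
      have := hP1 u T' (hs.trans hu.1) (hu.2.le.trans hmT) (B u (y u) - A u (y u))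
        (by rw [map_sub, hτA, hτB, sub_zero])
      exact this.trans (mul_le_mul_of_nonneg_left (hdiff u hu.1) (by positivity))
  have h2 : ‖g T' - g m‖ ≤ ΔL * N * (T' - m) :=
    norm_image_sub_le_of_norm_deriv_right_le_segment (hgc m T' hsm)
      (fun u hu => (hgd u (hsm.trans hu.1)).hasDerivWithinAt)
      (fun u hu => (hP2 u T' hu.2.le _).trans (hdiff u (hsm.trans hu.1))) T' ⟨hmT, le_rfl⟩
  have h3 : g T' = y T' := hUV' _ _
  have h4 : ‖y T'‖ ≤ ‖g T' - g m‖ + ‖g m‖ := by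
    rw [← h3]; simpa using norm_add_le (g T' - g m) (g m)
  have h5 : T' - m = Real.log K / γ := by rw [hm]; ring
  rw [h5] at h2
  calc ‖y T'‖ ≤ ΔL * N * (Real.log K / γ) + (K * Real.exp (-γ * T) * N + ΔL * N / γ) := by linarith
    _ = _ := by field_simp; ring

lemma iterate_bound {B : ℝ → E →L[ℝ] E} (τ : E →L[ℝ] ℝ) (hτB : ∀ t x, τ (B t x) = 0)
    (hDB : ∀ t x, ∃ C, ∀ h : ℝ, 0 ≤ h → ‖x + h • B t x‖ ≤ ‖x‖ + C * h ^ 2)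
    {q T : ℝ} (hq0 : 0 < q) (hq1 : q < 1) (hT : 0 < T)
    (hstep : ∀ s, 0 ≤ s → ∀ y : ℝ → E, (∀ u, s ≤ u → HasDerivAt y (B u (y u)) u) → τ (y s) = 0 →
      ‖y (s + T)‖ ≤ q * ‖y s‖)
    {s t : ℝ} (hs : 0 ≤ s) (hst : s ≤ t) {y : ℝ → E}
    (hy : ∀ u, s ≤ u → HasDerivAt y (B u (y u)) u) (hy0 : τ (y s) = 0) :
    ‖y t‖ ≤ q⁻¹ * Real.exp (-(-Real.log q / T) * (t - s)) * ‖y s‖ := by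
  have hτ : ∀ u, s ≤ u → τ (y u) = 0 := by
    intro u hu
    rw [← hy0]
    refine const_of_deriv_zero (f := fun u => τ (y u)) hu (fun r hr => ?_)
    have := τ.hasFDerivAt.comp_hasDerivAt r (hy r hr)
    rwa [hτB] at this
  have hn : ∀ n : ℕ, ‖y (s + n * T)‖ ≤ q ^ n * ‖y s‖ := by
    intro n
    induction n with
    | zero => simp
    | succ n ih =>
      have h0 : s ≤ s + n * T := le_add_of_nonneg_right (by positivity)
      have := hstep (s + n * T) (hs.trans h0) y (fun u hu => hy u (h0.trans hu)) (hτ _ h0)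
      have e : s + ((n + 1 : ℕ) : ℝ) * T = s + n * T + T := by push_cast; ring
      rw [e]
      calc _ ≤ _ := this
        _ ≤ q * (q ^ n * ‖y s‖) := mul_le_mul_of_nonneg_left ih hq0.le
        _ = _ := by ring
  set n := ⌊(t - s) / T⌋₊ with hnd
  have hts : 0 ≤ t - s := sub_nonneg.2 hst
  have hn1 : (n : ℝ) * T ≤ t - s := (le_div_iff₀ hT).1 (Nat.floor_le (by positivity))
  have hn2 : (t - s) / T < n + 1 := Nat.lt_floor_add_one _
  have h0 : s ≤ s + n * T := le_add_of_nonneg_right (by positivity)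
  have h1 : ‖y t‖ ≤ ‖y (s + n * T)‖ :=
    norm_antitone hDB (by linarith) (fun u hu => hy u (h0.trans hu))
  have h2 : q ^ n ≤ q⁻¹ * Real.exp (-(-Real.log q / T) * (t - s)) := by
    have hl : Real.log q < 0 := Real.log_neg hq0 hq1
    have e1 : q ^ n = Real.exp (n * Real.log q) := by
      rw [Real.exp_nat_mul, Real.exp_log hq0]
    have e2 : q⁻¹ = Real.exp (- Real.log q) := by rw [Real.exp_neg, Real.exp_log hq0]
    rw [e1, e2, ← Real.exp_add]
    apply Real.exp_le_exp.2
    have e3 : -(-Real.log q / T) * (t - s) = Real.log q * ((t - s) / T) := by ring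
    rw [e3]
    nlinarith
  calc _ ≤ _ := h1
    _ ≤ _ := hn n
    _ ≤ _ := mul_le_mul_of_nonneg_right h2 (norm_nonneg _)

lemma one_bound [FiniteDimensional ℝ E] {A B : ℝ → E →L[ℝ] E} (hA : Continuous A)
    (τ : E →L[ℝ] ℝ) (hτB : ∀ t x, τ (B t x) = 0)
    {γ ΔL : ℝ}
    (hc : ∀ s t, 0 ≤ s → s ≤ t → ∀ z : ℝ → E, (∀ u, HasDerivAt z (A u (z u)) u) → τ (z s) = 0 →
      ‖z t‖ ≤ Real.exp (-γ * (t - s)) * ‖z s‖)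
    (hΔ : ∀ t, 0 ≤ t → ∀ x, ‖B t x - A t x‖ ≤ ΔL * ‖x‖)
    {s t : ℝ} (hs : 0 ≤ s) (hst : s ≤ t)
    {y : ℝ → E} (hy : ∀ u, s ≤ u → HasDerivAt y (B u (y u)) u) (hy0 : τ (y s) = 0) :
    ‖y t‖ ≤ Real.exp (-(γ - ΔL) * (t - s)) * ‖y s‖ := by
  obtain ⟨U, V, hU, hV, hVU, hUV⟩ := exists_propagator hA
  have hUV' : ∀ t x, U t (V t x) = x := fun t x =>
    congrArg (fun f : E →L[ℝ] E => f x) (hUV t)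
  have hz : ∀ x r, HasDerivAt (fun r => U r x) (A r (U r x)) r := fun x r => by
    simpa using (hU r).clm_apply (hasDerivAt_const r x)
  have hτ : ∀ u, s ≤ u → τ (y u) = 0 := by
    intro u hu
    rw [← hy0]
    refine const_of_deriv_zero (f := fun u => τ (y u)) hu (fun r hr => ?_)
    have := τ.hasFDerivAt.comp_hasDerivAt r (hy r hr)
    rwa [hτB] at this
  have key := le_gronwallBound_of_liminf_deriv_right_le (f := fun u => ‖y u‖)
    (f' := fun u => -(γ - ΔL) * ‖y u‖) (δ := ‖y s‖) (K := -(γ - ΔL)) (ε := 0) (a := s) (b := t)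
    (fun u hu => (hy u hu.1).continuousAt.continuousWithinAt.norm) ?_ le_rfl
    (fun u _ => by simp) t ⟨hst, le_rfl⟩
  · rw [gronwallBound_ε0] at key
    linarith
  · intro u hu r hr
    apply Eventually.frequently
    have hu0 : 0 ≤ u := hs.trans hu.1
    set z := fun r => U r (V u (y u)) with hzd
    have hzu : z u = y u := hUV' _ _
    have hd : HasDerivAt (fun v => y v - z v) (B u (y u) - A u (y u)) u := by
      have := (hy u hu.1).sub (hz (V u (y u)) u)
      rw [hUV'] at this
      exact this
    have he : HasDerivAt (fun v => Real.exp (-γ * (v - u)) * ‖y u‖) (-γ * ‖y u‖) u := by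
      have hi : HasDerivAt (fun v => -γ * (v - u)) (-γ) u := by
        simpa using ((hasDerivAt_id u).sub_const u).const_mul (-γ)
      simpa using hi.exp.mul_const ‖y u‖
    set e := r - -(γ - ΔL) * ‖y u‖ with hed
    have he0 : 0 < e := sub_pos.2 hr
    have h1 := ((hasDerivAt_iff_isLittleO.1 hd).def (c := e / 4) (by positivity)).filter_mono
      (nhdsWithin_le_nhds (s := Ioi u))
    have h2 := ((hasDerivAt_iff_isLittleO.1 he).def (c := e / 4) (by positivity)).filter_mono
      (nhdsWithin_le_nhds (s := Ioi u))
    filter_upwards [h1, h2, self_mem_nhdsWithin] with v hv1 hv2 hv3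
    have hv : 0 < v - u := sub_pos.2 hv3
    rw [inv_mul_lt_iff₀ hv]
    have h3 : ‖z v‖ ≤ Real.exp (-γ * (v - u)) * ‖y u‖ := by
      have := hc u v hu0 hv3.le z (fun r => hz _ r) (by rw [hzu]; exact hτ u hu.1)
      rwa [hzu] at this
    rw [hzu, sub_self, sub_zero, Real.norm_of_nonneg hv.le] at hv1
    rw [Real.norm_of_nonneg hv.le, Real.norm_eq_abs] at hv2
    have hv2' := (abs_le.1 hv2).2
    simp only [sub_self, mul_zero, Real.exp_zero, one_mul, smul_eq_mul] at hv2'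
    have h4 : ‖y v - z v‖ ≤ e / 4 * (v - u) + (v - u) * (ΔL * ‖y u‖) := by
      have a1 := norm_add_le (y v - z v - (v - u) • (B u (y u) - A u (y u)))
        ((v - u) • (B u (y u) - A u (y u)))
      rw [sub_add_cancel, norm_smul, Real.norm_of_nonneg hv.le] at a1
      have a2 := mul_le_mul_of_nonneg_left (hΔ u hu0 (y u)) hv.le
      linarith
    have h5 : ‖y v‖ ≤ ‖y v - z v‖ + ‖z v‖ := by
      simpa using norm_add_le (y v - z v) (z v)
    have h6 : (v - u) * r = (v - u) * e + (v - u) * (-(γ - ΔL) * ‖y u‖) := by rw [hed]; ring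
    rw [h6]
    nlinarith [mul_pos hv he0]

theorem abstract_main [FiniteDimensional ℝ E] {A B : ℝ → E →L[ℝ] E} (hA : Continuous A)
    (τ : E →L[ℝ] ℝ) (hτA : ∀ t x, τ (A t x) = 0) (hτB : ∀ t x, τ (B t x) = 0)
    (hDA : ∀ t x, ∃ C, ∀ h : ℝ, 0 ≤ h → ‖x + h • A t x‖ ≤ ‖x‖ + C * h ^ 2)
    (hDB : ∀ t x, ∃ C, ∀ h : ℝ, 0 ≤ h → ‖x + h • B t x‖ ≤ ‖x‖ + C * h ^ 2)
    {K γ ΔL : ℝ} (hγ : 0 < γ) (hΔ0 : 0 ≤ ΔL)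
    (hc : ∀ s t, 0 ≤ s → s ≤ t → ∀ z : ℝ → E, (∀ u, HasDerivAt z (A u (z u)) u) → τ (z s) = 0 →
      ‖z t‖ ≤ K * Real.exp (-γ * (t - s)) * ‖z s‖)
    (hΔ : ∀ t, 0 ≤ t → ∀ x, ‖B t x - A t x‖ ≤ ΔL * ‖x‖)
    (hlt : ΔL < γ / (1 + Real.log K)) :
    (∃ K' γ' : ℝ, 0 < K' ∧ 0 < γ' ∧ ∀ s t, 0 ≤ s → s ≤ t → ∀ y : ℝ → E,
      (∀ u, s ≤ u → HasDerivAt y (B u (y u)) u) → τ (y s) = 0 →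
      ‖y t‖ ≤ K' * Real.exp (-γ' * (t - s)) * ‖y s‖) ∧
    (K = 1 → ∀ s t, 0 ≤ s → s ≤ t → ∀ y : ℝ → E,
      (∀ u, s ≤ u → HasDerivAt y (B u (y u)) u) → τ (y s) = 0 →
      ‖y t‖ ≤ 1 * Real.exp (-(γ - ΔL) * (t - s)) * ‖y s‖) := by
  refine ⟨?_, ?_⟩
  · by_cases hK : 1 ≤ K
    · have hlog : 0 ≤ Real.log K := Real.log_nonneg hK
      have hq' : ΔL * (1 + Real.log K) / γ < 1 := by
        rw [div_lt_one hγ]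
        exact (lt_div_iff₀ (by positivity)).1 hlt
      obtain ⟨T, hTq, hT1, hT2⟩ : ∃ T, K * Real.exp (-γ * T) + ΔL * (1 + Real.log K) / γ < 1 ∧
          Real.log K / γ ≤ T ∧ 0 < T := by
        have h1 : Tendsto (fun T => K * Real.exp (-γ * T) + ΔL * (1 + Real.log K) / γ) atTop
            (𝓝 (K * 0 + ΔL * (1 + Real.log K) / γ)) := by
          refine ((Real.tendsto_exp_atBot.comp ?_).const_mul K).add_const _
          exact tendsto_id.const_mul_atTop_of_neg (by linarith)
        rw [mul_zero, zero_add] at h1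
        exact ((h1.eventually (gt_mem_nhds hq')).and
          ((eventually_ge_atTop _).and (eventually_gt_atTop 0))).exists
      set q := K * Real.exp (-γ * T) + ΔL * (1 + Real.log K) / γ with hq
      have hq0 : 0 < q := by
        have : 0 < K := by linarith
        positivity
      refine ⟨q⁻¹, -Real.log q / T, by positivity,
        div_pos (neg_pos.2 (Real.log_neg hq0 hTq)) hT2, ?_⟩
      intro s t hs hst y hy hy0
      refine iterate_bound τ hτB hDB hq0 hTq hT2 ?_ hs hst hy hy0
      intro s hs y hy hy0
      exact step_bound hA τ hτA hτB hDA hDB hK hγ hΔ0 hc hΔ hs hT1 hy hy0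
    · refine ⟨1, 1, one_pos, one_pos, ?_⟩
      intro s t hs hst y hy hy0
      obtain ⟨U, V, hU, hV, hVU, hUV⟩ := exists_propagator hA
      have hUV' : ∀ t x, U t (V t x) = x := fun t x =>
        congrArg (fun f : E →L[ℝ] E => f x) (hUV t)
      have := hc s s hs le_rfl (fun r => U r (V s (y s))) (fun r => by
        simpa using (hU r).clm_apply (hasDerivAt_const r (V s (y s)))) (by simpa [hUV'] using hy0)
      simp only [hUV', sub_self, mul_zero, Real.exp_zero, mul_one] at this
      have h0 : ‖y s‖ = 0 := by
        have := norm_nonneg (y s)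
        nlinarith
      have := norm_antitone hDB hst hy
      rw [h0] at this ⊢
      simpa using this
  · rintro rfl s t hs hst y hy hy0
    rw [one_mul]
    exact one_bound hA τ hτB (by simpa using hc) hΔ hs hst hy hy0

end Abstract

section Concrete

variable {d : ℕ}

lemma traceNorm_eq {A : Matrix (Fin d) (Fin d) ℂ} (hA : A.IsHermitian) :
    traceNorm A = ∑ i, |hA.eigenvalues i| := by
  have hsq : (Aᴴ * A).charpoly = ∏ i, (Polynomial.X - Polynomial.C ((hA.eigenvalues i : ℂ) ^ 2)) := by
    have e : Aᴴ * A = Unitary.conjStarAlgAut ℂ _ hA.eigenvectorUnitary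
        (diagonal (fun i => (hA.eigenvalues i : ℂ) ^ 2)) := by
      have hh : Aᴴ = A := hA
      rw [hh]
      conv_lhs => rw [hA.spectral_theorem]
      rw [← map_mul, diagonal_mul_diagonal]
      congr 2
      funext i
      simp [sq]
    rw [e, Unitary.conjStarAlgAut_apply, charpoly_mul_comm, ← mul_assoc]
    simp [charpoly_diagonal]
  have h1 : (Aᴴ * A).charpoly.roots =
      Multiset.map (fun i => (hA.eigenvalues i : ℂ) ^ 2) Finset.univ.val := by
    rw [hsq, Polynomial.roots_prod]
    · simp only [Polynomial.roots_X_sub_C]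
      exact Multiset.bind_singleton _ _
    · exact Finset.prod_ne_zero_iff.2 fun i _ => Polynomial.X_sub_C_ne_zero _
  have h2 := (Matrix.posSemidef_conjTranspose_mul_self A).isHermitian.roots_charpoly_eq_eigenvalues
  rw [h1] at h2
  have h3 := congrArg (fun m : Multiset ℂ => (m.map (fun z => Real.sqrt z.re)).sum) h2
  simp only [Multiset.map_map] at h3
  unfold traceNorm
  rw [Finset.sum, Finset.sum]
  refine Eq.trans ?_ (h3.symm.trans ?_)
  · congr 1
  · congr 1
    apply Multiset.map_congr rfl
    intro i _
    have : ((hA.eigenvalues i : ℂ) ^ 2).re = (hA.eigenvalues i) ^ 2 := by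
      rw [← Complex.ofReal_pow, Complex.ofReal_re]
    simp only [Function.comp_apply, this]
    exact Real.sqrt_sq_eq_abs _

lemma traceNorm_sub_le {P Q : Matrix (Fin d) (Fin d) ℂ} (hP : P.PosSemidef) (hQ : Q.PosSemidef) :
    traceNorm (P - Q) ≤ P.trace.re + Q.trace.re := by
  have hA : (P - Q).IsHermitian := hP.isHermitian.sub hQ.isHermitian
  rw [traceNorm_eq hA]
  set U : Matrix (Fin d) (Fin d) ℂ := (hA.eigenvectorUnitary : Matrix (Fin d) (Fin d) ℂ) with hU
  have hUU : U * Uᴴ = 1 := Unitary.mul_star_self_of_mem hA.eigenvectorUnitary.2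
  have hUU' : Uᴴ * U = 1 := Unitary.star_mul_self_of_mem hA.eigenvectorUnitary.2
  have hsp : P - Q = U * diagonal (fun i => (hA.eigenvalues i : ℂ)) * Uᴴ := hA.spectral_theorem
  have hdiag : Uᴴ * P * U - Uᴴ * Q * U = diagonal (fun i => (hA.eigenvalues i : ℂ)) := by
    rw [← sub_mul, ← mul_sub]
    calc _ = Uᴴ * (U * diagonal (fun i => (hA.eigenvalues i : ℂ)) * Uᴴ) * U :=
          congrArg (fun X => Uᴴ * X * U) hsp
      _ = (Uᴴ * U) * diagonal (fun i => (hA.eigenvalues i : ℂ)) * (Uᴴ * U) := by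
          simp only [mul_assoc]
      _ = _ := by rw [hUU']; simp
  have htr : ∀ M : Matrix (Fin d) (Fin d) ℂ, M.trace.re = ∑ i, ((Uᴴ * M * U) i i).re := by
    intro M
    have : M.trace = (Uᴴ * M * U).trace := by
      rw [Matrix.trace_mul_comm, ← mul_assoc, hUU, one_mul]
    rw [this, Matrix.trace, Complex.re_sum]; rfl
  rw [htr P, htr Q, ← Finset.sum_add_distrib]
  apply Finset.sum_le_sum
  intro i _
  have hp : 0 ≤ ((Uᴴ * P * U) i i).re :=
    (Complex.le_def.1 ((hP.conjTranspose_mul_mul_same U).diag_nonneg (i := i))).1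
  have hq : 0 ≤ ((Uᴴ * Q * U) i i).re :=
    (Complex.le_def.1 ((hQ.conjTranspose_mul_mul_same U).diag_nonneg (i := i))).1
  have hi : hA.eigenvalues i = ((Uᴴ * P * U) i i).re - ((Uᴴ * Q * U) i i).re := by
    have := congrArg (fun M : Matrix (Fin d) (Fin d) ℂ => (M i i).re) hdiag
    simpa using this.symm
  rw [hi, abs_le]
  constructor <;> linarith

lemma exists_jordan {A : Matrix (Fin d) (Fin d) ℂ} (hA : A.IsHermitian) :
    ∃ P Q : Matrix (Fin d) (Fin d) ℂ, P.PosSemidef ∧ Q.PosSemidef ∧ A = P - Q ∧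
      P.trace.re + Q.trace.re = traceNorm A := by
  set U : Matrix (Fin d) (Fin d) ℂ := (hA.eigenvectorUnitary : Matrix (Fin d) (Fin d) ℂ) with hU
  have hUU' : Uᴴ * U = 1 := Unitary.star_mul_self_of_mem hA.eigenvectorUnitary.2
  have hsp : A = U * diagonal (fun i => (hA.eigenvalues i : ℂ)) * Uᴴ := hA.spectral_theorem
  have hps : ∀ f : Fin d → ℝ, (∀ i, 0 ≤ f i) →
      (U * diagonal (fun i => (f i : ℂ)) * Uᴴ).PosSemidef := by
    intro f hf
    apply Matrix.PosSemidef.mul_mul_conjTranspose_same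
    apply Matrix.PosSemidef.diagonal
    intro i
    simpa using hf i
  have htr : ∀ f : Fin d → ℝ, (U * diagonal (fun i => (f i : ℂ)) * Uᴴ).trace.re = ∑ i, f i := by
    intro f
    rw [Matrix.trace_mul_comm, ← mul_assoc, hUU', one_mul, Matrix.trace_diagonal, Complex.re_sum]
    simp
  refine ⟨U * diagonal (fun i => ((max (hA.eigenvalues i) 0 : ℝ) : ℂ)) * Uᴴ,
    U * diagonal (fun i => ((max (-hA.eigenvalues i) 0 : ℝ) : ℂ)) * Uᴴ,
    hps _ (fun i => le_max_right _ _), hps _ (fun i => le_max_right _ _), ?_, ?_⟩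
  · rw [← sub_mul, ← mul_sub, diagonal_sub]
    conv_lhs => rw [hsp]
    congr 3
    funext i
    rw [← Complex.ofReal_sub]
    congr 1
    exact (max_zero_sub_eq_self (hA.eigenvalues i)).symm
  · rw [htr, htr, traceNorm_eq hA, ← Finset.sum_add_distrib]
    apply Finset.sum_congr rfl
    intro i _
    exact max_zero_add_max_neg_zero_eq_abs_self _

lemma traceNorm_nonneg (A : Matrix (Fin d) (Fin d) ℂ) : 0 ≤ traceNorm A :=
  Finset.sum_nonneg fun _ _ => Real.sqrt_nonneg _

lemma psd_trace_re_nonneg {P : Matrix (Fin d) (Fin d) ℂ} (hP : P.PosSemidef) : 0 ≤ P.trace.re :=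
  (Complex.le_def.1 hP.trace_nonneg).1

lemma psd_trace_eq {P : Matrix (Fin d) (Fin d) ℂ} (hP : P.PosSemidef) :
    P.trace = (P.trace.re : ℂ) := by
  have := (Complex.le_def.1 hP.trace_nonneg).2
  apply Complex.ext <;> simp_all

lemma psd_smul {P : Matrix (Fin d) (Fin d) ℂ} (hP : P.PosSemidef) {c : ℝ} (hc : 0 ≤ c) :
    (c • P).PosSemidef := hP.smul hc

lemma trace_re_smul (c : ℝ) (P : Matrix (Fin d) (Fin d) ℂ) :
    (c • P).trace.re = c * P.trace.re := by
  rw [Matrix.trace_smul]; simp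

lemma traceNorm_eq_zero {A : Matrix (Fin d) (Fin d) ℂ} (hA : A.IsHermitian)
    (h : traceNorm A = 0) : A = 0 := by
  obtain ⟨P, Q, hP, hQ, rfl, ht⟩ := exists_jordan hA
  have h1 := psd_trace_re_nonneg hP
  have h2 := psd_trace_re_nonneg hQ
  have e1 : P.trace.re = 0 := by linarith
  have e2 : Q.trace.re = 0 := by linarith
  have : P = 0 := hP.trace_eq_zero_iff.1 (by rw [psd_trace_eq hP, e1]; simp)
  have : Q = 0 := hQ.trace_eq_zero_iff.1 (by rw [psd_trace_eq hQ, e2]; simp)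
  simp_all

lemma traceNorm_add_le {A B : Matrix (Fin d) (Fin d) ℂ} (hA : A.IsHermitian)
    (hB : B.IsHermitian) : traceNorm (A + B) ≤ traceNorm A + traceNorm B := by
  obtain ⟨P, Q, hP, hQ, rfl, ht⟩ := exists_jordan hA
  obtain ⟨P', Q', hP', hQ', rfl, ht'⟩ := exists_jordan hB
  have := traceNorm_sub_le (hP.add hP') (hQ.add hQ')
  rw [show P - Q + (P' - Q') = P + P' - (Q + Q') by abel]
  rw [Matrix.trace_add, Matrix.trace_add, Complex.add_re, Complex.add_re] at this
  linarith

lemma traceNorm_smul_le {A : Matrix (Fin d) (Fin d) ℂ} (hA : A.IsHermitian) (c : ℝ) :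
    traceNorm (c • A) ≤ |c| * traceNorm A := by
  obtain ⟨P, Q, hP, hQ, rfl, ht⟩ := exists_jordan hA
  rcases le_total 0 c with hc | hc
  · have := traceNorm_sub_le (psd_smul hP hc) (psd_smul hQ hc)
    rw [← smul_sub, trace_re_smul, trace_re_smul] at this
    rw [abs_of_nonneg hc, ← ht]
    linarith
  · have hc' : 0 ≤ -c := by linarith
    have := traceNorm_sub_le (psd_smul hQ hc') (psd_smul hP hc')
    rw [← smul_sub, trace_re_smul, trace_re_smul, neg_smul, ← smul_neg, neg_sub] at this
    rw [abs_of_nonpos hc, ← ht]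
    linarith

lemma isHermitian_real_smul {A : Matrix (Fin d) (Fin d) ℂ} (hA : A.IsHermitian) (c : ℝ) :
    (c • A).IsHermitian := by
  have hh : Aᴴ = A := hA
  show (c • A)ᴴ = c • A
  rw [Matrix.conjTranspose_smul, hh, star_trivial]

lemma traceNorm_smul {A : Matrix (Fin d) (Fin d) ℂ} (hA : A.IsHermitian) (c : ℝ) :
    traceNorm (c • A) = |c| * traceNorm A := by
  refine le_antisymm (traceNorm_smul_le hA c) ?_
  by_cases hc : c = 0
  · subst hc; simpa using traceNorm_nonneg _
  · have := traceNorm_smul_le (isHermitian_real_smul hA c) c⁻¹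
    rw [smul_smul, inv_mul_cancel₀ hc, one_smul, abs_inv] at this
    rwa [le_inv_mul_iff₀ (abs_pos.2 hc)] at this

/-- The Lindblad generator. -/
noncomputable def gen {m : ℕ} (H : Matrix (Fin d) (Fin d) ℂ) (J : Fin m → Matrix (Fin d) (Fin d) ℂ)
    (x : Matrix (Fin d) (Fin d) ℂ) : Matrix (Fin d) (Fin d) ℂ :=
  hamTerm H x + totalDissipator J x

lemma gen_add {m : ℕ} (H : Matrix (Fin d) (Fin d) ℂ) (J : Fin m → Matrix (Fin d) (Fin d) ℂ)
    (x y : Matrix (Fin d) (Fin d) ℂ) : gen H J (x + y) = gen H J x + gen H J y := by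
  have h1 : hamTerm H (x + y) = hamTerm H x + hamTerm H y := by
    simp only [hamTerm, mul_add, add_mul, ← smul_add]
    congr 1
    abel
  have h2 : totalDissipator J (x + y) = totalDissipator J x + totalDissipator J y := by
    simp only [totalDissipator, ← Finset.sum_add_distrib]
    refine Finset.sum_congr rfl fun j _ => ?_
    simp only [dissipator, mul_add, add_mul, smul_add]
    abel
  rw [gen, gen, gen, h1, h2]
  abel

lemma gen_smul {m : ℕ} (H : Matrix (Fin d) (Fin d) ℂ) (J : Fin m → Matrix (Fin d) (Fin d) ℂ)
    (c : ℂ) (x : Matrix (Fin d) (Fin d) ℂ) : gen H J (c • x) = c • gen H J x := by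
  simp only [gen, hamTerm, totalDissipator, dissipator, Matrix.mul_smul, Matrix.smul_mul,
    smul_add, Finset.smul_sum, smul_sub]
  simp only [smul_comm c]

lemma gen_conjTranspose {m : ℕ} {H : Matrix (Fin d) (Fin d) ℂ} (hH : H.IsHermitian)
    (J : Fin m → Matrix (Fin d) (Fin d) ℂ)
    (x : Matrix (Fin d) (Fin d) ℂ) : gen H J xᴴ = (gen H J x)ᴴ := by
  have hh : Hᴴ = H := hH
  have h1 : hamTerm H xᴴ = (hamTerm H x)ᴴ := by
    simp only [hamTerm, Matrix.conjTranspose_smul, Matrix.conjTranspose_sub,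
      Matrix.conjTranspose_mul, hh]
    simp only [Complex.star_def, map_neg, Complex.conj_I, neg_smul, smul_sub, neg_neg]
    abel
  have h2 : totalDissipator J xᴴ = (totalDissipator J x)ᴴ := by
    simp only [totalDissipator, Matrix.conjTranspose_sum]
    refine Finset.sum_congr rfl fun j _ => ?_
    simp only [dissipator, Matrix.conjTranspose_smul, Matrix.conjTranspose_sub,
      Matrix.conjTranspose_add, Matrix.conjTranspose_mul, Matrix.conjTranspose_conjTranspose]
    have : star ((1 : ℂ) / 2) = 1 / 2 := by simp
    rw [this, add_comm, mul_assoc, mul_assoc]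
  rw [gen, gen, h1, h2, Matrix.conjTranspose_add]

lemma trace_gen {m : ℕ} (H : Matrix (Fin d) (Fin d) ℂ) (J : Fin m → Matrix (Fin d) (Fin d) ℂ)
    (x : Matrix (Fin d) (Fin d) ℂ) : (gen H J x).trace = 0 := by
  have h1 : (hamTerm H x).trace = 0 := by
    simp only [hamTerm, Matrix.trace_smul, Matrix.trace_sub]
    rw [Matrix.trace_mul_comm x H, sub_self, smul_zero]
  have h2 : (totalDissipator J x).trace = 0 := by
    simp only [totalDissipator, Matrix.trace_sum]
    refine Finset.sum_eq_zero fun j _ => ?_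
    simp only [dissipator, Matrix.trace_smul, Matrix.trace_sub, Matrix.trace_add]
    rw [Matrix.trace_mul_comm x, Matrix.trace_mul_comm (J j * x), ← mul_assoc, smul_eq_mul]
    ring
  rw [gen, Matrix.trace_add, h1, h2, add_zero]

/-- The effective non-Hermitian drift. -/
noncomputable def drift {m : ℕ} (H : Matrix (Fin d) (Fin d) ℂ)
    (J : Fin m → Matrix (Fin d) (Fin d) ℂ) : Matrix (Fin d) (Fin d) ℂ :=
  (-Complex.I) • H - ((1 : ℂ) / 2) • ∑ j, (J j)ᴴ * J j

lemma gen_eq {m : ℕ} {H : Matrix (Fin d) (Fin d) ℂ} (hH : H.IsHermitian)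
    (J : Fin m → Matrix (Fin d) (Fin d) ℂ) (x : Matrix (Fin d) (Fin d) ℂ) :
    gen H J x = drift H J * x + x * (drift H J)ᴴ + ∑ j, J j * x * (J j)ᴴ := by
  have hh : Hᴴ = H := hH
  have hG : (drift H J)ᴴ = Complex.I • H - ((1 : ℂ) / 2) • ∑ j, (J j)ᴴ * J j := by
    simp only [drift, Matrix.conjTranspose_smul, Matrix.conjTranspose_sub, hh,
      Matrix.conjTranspose_sum, Matrix.conjTranspose_mul, Matrix.conjTranspose_conjTranspose]
    simp
  rw [hG]
  have h2 : totalDissipator J x = ∑ j, J j * x * (J j)ᴴ -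
      ((1 : ℂ) / 2) • ((∑ j, (J j)ᴴ * J j) * x + x * ∑ j, (J j)ᴴ * J j) := by
    simp only [totalDissipator, dissipator, Finset.sum_sub_distrib, Finset.sum_mul, Finset.mul_sum,
      ← Finset.sum_add_distrib, ← Finset.smul_sum]
  rw [gen, h2, drift, hamTerm, sub_mul, mul_sub, Matrix.smul_mul, Matrix.smul_mul, Matrix.mul_smul,
    Matrix.mul_smul, smul_add, smul_sub, neg_smul, neg_smul]
  abel

/-- Infinitesimal contractivity of the trace norm. -/
lemma gen_dissipative {m : ℕ} {H : Matrix (Fin d) (Fin d) ℂ} (hH : H.IsHermitian)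
    (J : Fin m → Matrix (Fin d) (Fin d) ℂ) {x : Matrix (Fin d) (Fin d) ℂ} (hx : x.IsHermitian) :
    ∃ C : ℝ, ∀ h : ℝ, 0 ≤ h → traceNorm (x + h • gen H J x) ≤ traceNorm x + C * h ^ 2 := by
  obtain ⟨P, Q, hP, hQ, rfl, ht⟩ := exists_jordan hx
  set G := drift H J with hG
  refine ⟨2 * ((G * P * Gᴴ).trace.re + (G * Q * Gᴴ).trace.re), fun h hh => ?_⟩
  have hh2 : 0 ≤ h ^ 2 := sq_nonneg h
  -- the positive part of the Euler step
  have hid : ∀ M, M + h • gen H J M =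
      (1 + h • G) * M * (1 + h • G)ᴴ + h • ∑ j, J j * M * (J j)ᴴ - h ^ 2 • (G * M * Gᴴ) := by
    intro M
    rw [gen_eq hH, Matrix.conjTranspose_add, Matrix.conjTranspose_one, Matrix.conjTranspose_smul,
      star_trivial]
    simp only [add_mul, mul_add, one_mul, mul_one, smul_add, Matrix.smul_mul, Matrix.mul_smul,
      smul_smul, sq, hG]
    abel
  have hpos : ∀ M : Matrix (Fin d) (Fin d) ℂ, M.PosSemidef →
      (M + h • gen H J M + h ^ 2 • (G * M * Gᴴ)).PosSemidef := by
    intro M hM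
    rw [hid, sub_add_cancel]
    refine (hM.mul_mul_conjTranspose_same _).add (psd_smul ?_ hh)
    exact Matrix.posSemidef_sum _ fun j _ => hM.mul_mul_conjTranspose_same _
  have hGp : ∀ M : Matrix (Fin d) (Fin d) ℂ, M.PosSemidef → (h ^ 2 • (G * M * Gᴴ)).PosSemidef :=
    fun M hM => psd_smul (hM.mul_mul_conjTranspose_same _) hh2
  have key := traceNorm_sub_le ((hpos P hP).add (hGp Q hQ)) ((hpos Q hQ).add (hGp P hP))
  have e1 : (P + h • gen H J P + h ^ 2 • (G * P * Gᴴ) + h ^ 2 • (G * Q * Gᴴ)) -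
      (Q + h • gen H J Q + h ^ 2 • (G * Q * Gᴴ) + h ^ 2 • (G * P * Gᴴ)) =
      P - Q + h • gen H J (P - Q) := by
    have : gen H J (P - Q) = gen H J P - gen H J Q := by
      have := gen_add H J (P - Q) Q
      rw [sub_add_cancel] at this
      rw [this]; abel
    rw [this, smul_sub]
    abel
  rw [e1] at key
  have htg : ∀ M, (h • gen H J M).trace.re = 0 := fun M => by
    rw [trace_re_smul, trace_gen]; simp
  simp only [Matrix.trace_add, Complex.add_re, htg, trace_re_smul] at key
  rw [← ht]
  linarith

/-- Hermitian matrices as a real subspace. -/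
def hermSub (d : ℕ) : Submodule ℝ (Matrix (Fin d) (Fin d) ℂ) where
  carrier := {A | A.IsHermitian}
  add_mem' := fun {a b} (ha : a.IsHermitian) (hb : b.IsHermitian) => ha.add hb
  zero_mem' := Matrix.isHermitian_zero
  smul_mem' := fun c _ hA => isHermitian_real_smul hA c

/-- Hermitian matrices with the trace norm. -/
def Herm (d : ℕ) : Type := hermSub d

noncomputable instance : AddCommGroup (Herm d) := inferInstanceAs (AddCommGroup (hermSub d))
noncomputable instance : Module ℝ (Herm d) := inferInstanceAs (Module ℝ (hermSub d))

/-- Inclusion into matrices. -/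
noncomputable def Herm.val : Herm d →ₗ[ℝ] Matrix (Fin d) (Fin d) ℂ := (hermSub d).subtype

lemma Herm.isHermitian (x : Herm d) : (Herm.val x).IsHermitian := x.2

lemma Herm.val_injective : Function.Injective (Herm.val (d := d)) := Subtype.val_injective

/-- Constructor. -/
def Herm.mk (A : Matrix (Fin d) (Fin d) ℂ) (hA : A.IsHermitian) : Herm d := ⟨A, hA⟩

@[simp] lemma Herm.val_mk (A : Matrix (Fin d) (Fin d) ℂ) (hA : A.IsHermitian) :
    Herm.val (Herm.mk A hA) = A := rfl

noncomputable instance : Norm (Herm d) := ⟨fun x => traceNorm (Herm.val x)⟩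

lemma Herm.norm_def (x : Herm d) : ‖x‖ = traceNorm (Herm.val x) := rfl

lemma hermCore (d : ℕ) : NormedSpace.Core ℝ (Herm d) where
  norm_nonneg x := traceNorm_nonneg _
  norm_smul c x := by
    rw [Herm.norm_def, map_smul, traceNorm_smul x.isHermitian]; rfl
  norm_triangle x y := by
    rw [Herm.norm_def, map_add]
    exact traceNorm_add_le x.isHermitian y.isHermitian
  norm_eq_zero_iff x := by
    constructor
    · intro h
      apply Herm.val_injective
      rw [map_zero]
      exact traceNorm_eq_zero x.isHermitian h
    · rintro rfl
      have := traceNorm_smul (Matrix.isHermitian_zero (n := Fin d) (α := ℂ)) 0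
      rw [Herm.norm_def, map_zero]
      simpa using this

noncomputable instance : NormedAddCommGroup (Herm d) := NormedAddCommGroup.ofCore (hermCore d)
noncomputable instance : NormedSpace ℝ (Herm d) := NormedSpace.ofCore (hermCore d)

instance : FiniteDimensional ℝ (Herm d) :=
  FiniteDimensional.of_injective (Herm.val (d := d)) Herm.val_injective

/-- Hermitian part. -/
noncomputable def hermPart : (Fin d → Fin d → ℂ) →ₗ[ℝ] Herm d where
  toFun M := Herm.mk ((1 / 2 : ℝ) • (Matrix.of M + (Matrix.of M)ᴴ))
    (isHermitian_real_smul (Matrix.isHermitian_add_transpose_self _) _)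
  map_add' M N := by
    apply Herm.val_injective
    simp only [Herm.val_mk, map_add, ← Matrix.of_add_of, Matrix.conjTranspose_add, ← smul_add]
    congr 1
    abel
  map_smul' c M := by
    apply Herm.val_injective
    simp only [Herm.val_mk, map_smul, RingHom.id_apply, ← Matrix.smul_of,
      Matrix.conjTranspose_smul, star_trivial, ← smul_add]
    rw [smul_comm]

lemma val_hermPart (M : Matrix (Fin d) (Fin d) ℂ) :
    Herm.val (hermPart M) = (1 / 2 : ℝ) • (M + Mᴴ) := rfl

lemma hermPart_val (x : Herm d) : hermPart (Herm.val x) = x := by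
  apply Herm.val_injective
  have hh : (Herm.val x)ᴴ = Herm.val x := x.isHermitian
  rw [val_hermPart, hh, ← two_smul ℝ (Herm.val x), smul_smul]
  norm_num

/-- Continuous version of the Hermitian part. -/
noncomputable def hermPartL : (Fin d → Fin d → ℂ) →L[ℝ] Herm d :=
  LinearMap.toContinuousLinearMap hermPart

/-- Entry functional. -/
noncomputable def entryL (i j : Fin d) : Herm d →L[ℝ] ℂ :=
  LinearMap.toContinuousLinearMap
    { toFun := fun x => Herm.val x i j
      map_add' := fun x y => by rw [map_add]; rfl
      map_smul' := fun c x => by rw [map_smul]; rfl }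

/-- Trace functional. -/
noncomputable def traceL : Herm d →L[ℝ] ℝ :=
  LinearMap.toContinuousLinearMap
    { toFun := fun x => (Herm.val x).trace.re
      map_add' := fun x y => by rw [map_add, Matrix.trace_add, Complex.add_re]
      map_smul' := fun c x => by rw [map_smul, trace_re_smul]; rfl }

lemma traceL_apply (x : Herm d) : traceL x = (Herm.val x).trace.re := rfl

lemma gen_real_smul {m : ℕ} (H : Matrix (Fin d) (Fin d) ℂ) (J : Fin m → Matrix (Fin d) (Fin d) ℂ)
    (c : ℝ) (x : Matrix (Fin d) (Fin d) ℂ) : gen H J (c • x) = c • gen H J x := by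
  have := gen_smul H J (c : ℂ) x
  simpa using this

lemma gen_isHermitian {m : ℕ} {H : Matrix (Fin d) (Fin d) ℂ} (hH : H.IsHermitian)
    (J : Fin m → Matrix (Fin d) (Fin d) ℂ) {x : Matrix (Fin d) (Fin d) ℂ} (hx : x.IsHermitian) :
    (gen H J x).IsHermitian := by
  have hh : xᴴ = x := hx
  have := gen_conjTranspose hH J x
  rw [hh] at this
  exact this.symm

/-- The generator acting on Hermitian matrices. -/
noncomputable def genL {m : ℕ} (H : Matrix (Fin d) (Fin d) ℂ) (hH : H.IsHermitian)
    (J : Fin m → Matrix (Fin d) (Fin d) ℂ) : Herm d →L[ℝ] Herm d :=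
  LinearMap.toContinuousLinearMap
    { toFun := fun x => Herm.mk (gen H J (Herm.val x)) (gen_isHermitian hH J x.isHermitian)
      map_add' := fun x y => by
        apply Herm.val_injective
        simp only [Herm.val_mk, map_add, gen_add]
      map_smul' := fun c x => by
        apply Herm.val_injective
        simp only [Herm.val_mk, map_smul, gen_real_smul, RingHom.id_apply] }

lemma val_genL {m : ℕ} (H : Matrix (Fin d) (Fin d) ℂ) (hH : H.IsHermitian)
    (J : Fin m → Matrix (Fin d) (Fin d) ℂ) (x : Herm d) :
    Herm.val (genL H hH J x) = gen H J (Herm.val x) := rfl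

lemma genL_hermPart {m : ℕ} (H : Matrix (Fin d) (Fin d) ℂ) (hH : H.IsHermitian)
    (J : Fin m → Matrix (Fin d) (Fin d) ℂ) (M : Matrix (Fin d) (Fin d) ℂ) :
    genL H hH J (hermPart M) = hermPart (gen H J M) := by
  apply Herm.val_injective
  rw [val_genL, val_hermPart, val_hermPart, gen_real_smul, gen_add, gen_conjTranspose hH]

lemma continuous_genL {m : ℕ} {H : ℝ → Matrix (Fin d) (Fin d) ℂ} (hH : IsHamiltonianFamily H)
    {J : ℝ → Fin m → Matrix (Fin d) (Fin d) ℂ} (hJ : ∀ j i k, Continuous fun t => J t j i k) :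
    Continuous fun t => genL (H t) (hH.1 t) (J t) := by
  rw [continuous_clm_apply]
  intro x
  have e : (fun t => genL (H t) (hH.1 t) (J t) x) =
      fun t => hermPartL (gen (H t) (J t) (Herm.val x)) := by
    funext t
    exact (hermPart_val _).symm
  rw [e]
  refine hermPartL.continuous.comp ?_
  have cH : Continuous H := continuous_matrix hH.2
  have cJ : ∀ j, Continuous fun t => J t j := fun j => continuous_matrix (hJ j)
  have : Continuous fun t => gen (H t) (J t) (Herm.val x) := by
    simp only [gen, hamTerm, totalDissipator, dissipator]
    fun_prop
  exact this

/-- Entrywise solutions from solutions in `Herm`. -/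
lemma entry_hasDerivAt {z : ℝ → Herm d} {z' : Herm d} {t : ℝ} (h : HasDerivAt z z' t)
    (i j : Fin d) : HasDerivAt (fun u => Herm.val (z u) i j) (Herm.val z' i j) t :=
  (entryL i j).hasFDerivAt.comp_hasDerivAt t h

lemma hermPart_hasDerivAt {M : ℝ → Matrix (Fin d) (Fin d) ℂ} {M' : Matrix (Fin d) (Fin d) ℂ} {t : ℝ}
    (h : ∀ i j, HasDerivAt (fun u => M u i j) (M' i j) t) :
    HasDerivAt (fun u => hermPart (M u)) (hermPart M') t := by
  have h1 : HasDerivAt (F := Fin d → Fin d → ℂ) M M' t :=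
    hasDerivAt_pi.2 fun i => hasDerivAt_pi.2 fun j => h i j
  exact (hermPartL (d := d)).hasFDerivAt.comp_hasDerivAt t h1

/-- Any difference of solutions with Hermitian start is a Hermitian solution. -/
lemma solution_herm {m : ℕ} {H : ℝ → Matrix (Fin d) (Fin d) ℂ} (hH : IsHamiltonianFamily H)
    {J : ℝ → Fin m → Matrix (Fin d) (Fin d) ℂ} {s : ℝ} {M : ℝ → Matrix (Fin d) (Fin d) ℂ}
    (hM : IsSolution (fun t x => gen (H t) (J t) x) s M) (hs : (M s).IsHermitian) :
    (∀ u, s ≤ u → HasDerivAt (fun u => hermPart (M u))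
      (genL (H u) (hH.1 u) (J u) (hermPart (M u))) u) ∧
    ∀ u, s ≤ u → Herm.val (hermPart (M u)) = M u := by
  refine ⟨fun u hu => ?_, fun u hu => ?_⟩
  · rw [genL_hermPart]
    exact hermPart_hasDerivAt (hM u hu)
  · -- the skew part vanishes
    have hskew : ∀ v, s ≤ v → HasDerivAt (fun v => hermPart (Complex.I • M v))
        (genL (H v) (hH.1 v) (J v) (hermPart (Complex.I • M v))) v := by
      intro v hv
      rw [genL_hermPart]
      refine hermPart_hasDerivAt fun i j => ?_
      rw [gen_smul]
      exact (hM v hv i j).const_mul Complex.I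
    have hmono := norm_antitone (A := fun t => genL (H t) (hH.1 t) (J t))
      (fun t x => gen_dissipative (hH.1 t) (J t) x.isHermitian) hu hskew
    have hcalc : ∀ N : Matrix (Fin d) (Fin d) ℂ,
        Herm.val (hermPart (Complex.I • N)) = (1 / 2 : ℝ) • (Complex.I • (N - Nᴴ)) := by
      intro N
      rw [val_hermPart, Matrix.conjTranspose_smul]
      simp [smul_sub, sub_eq_add_neg]
    have h0 : hermPart (Complex.I • M s) = 0 := by
      apply Herm.val_injective
      have hh : (M s)ᴴ = M s := hs
      rw [hcalc, hh]
      simp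
    rw [h0, norm_zero] at hmono
    have h1 : hermPart (Complex.I • M u) = 0 := norm_le_zero_iff.1 hmono
    have h2 := hcalc (M u)
    rw [h1, map_zero] at h2
    have h3 : M u - (M u)ᴴ = 0 := by
      have := h2.symm
      rw [smul_eq_zero] at this
      rcases this with h | h
      · norm_num at h
      · exact (smul_eq_zero.1 h).resolve_left Complex.I_ne_zero
    have h4 : (M u).IsHermitian := (sub_eq_zero.1 h3).symm
    exact congrArg Herm.val (hermPart_val (Herm.mk (M u) h4))

/-- Contractivity on densities gives contractivity on traceless Hermitian matrices. -/
lemma contr_herm {m : ℕ} {H : ℝ → Matrix (Fin d) (Fin d) ℂ} (hH : IsHamiltonianFamily H)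
    {J : ℝ → Fin m → Matrix (Fin d) (Fin d) ℂ} (hJ : ∀ j i k, Continuous fun t => J t j i k)
    {K γ : ℝ} (hcontr : ExpContractiveWith (fun t x => gen (H t) (J t) x) K γ)
    (s t : ℝ) (hs : 0 ≤ s) (hst : s ≤ t) (z : ℝ → Herm d)
    (hz : ∀ u, HasDerivAt z (genL (H u) (hH.1 u) (J u) (z u)) u) (hz0 : traceL (z s) = 0) :
    ‖z t‖ ≤ K * Real.exp (-γ * (t - s)) * ‖z s‖ := by
  obtain ⟨P, Q, hP, hQ, hPQ, ht⟩ := exists_jordan (z s).isHermitian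
  have hP0 := psd_trace_re_nonneg hP
  have htr : P.trace.re = Q.trace.re := by
    rw [traceL_apply, hPQ, Matrix.trace_sub, Complex.sub_re] at hz0
    linarith
  set c := P.trace.re with hc
  rcases hP0.eq_or_lt with h0 | h0
  · have e0 : ‖z s‖ = 0 := by rw [Herm.norm_def]; linarith
    have := norm_antitone (A := fun t => genL (H t) (hH.1 t) (J t))
      (fun t x => gen_dissipative (hH.1 t) (J t) x.isHermitian) hst (fun u _ => hz u)
    rw [e0] at this ⊢
    simpa using this
  · obtain ⟨U, V, hU, hV, hVU, hUV⟩ := exists_propagator (continuous_genL hH hJ)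
    set x0 : Herm d := Herm.mk (c⁻¹ • P) (isHermitian_real_smul hP.isHermitian _) with hx0
    set ρ : ℝ → Herm d := fun r => U r (V s x0) with hρ
    have hρs : ρ s = x0 := congrArg (fun f : Herm d →L[ℝ] Herm d => f x0) (hUV s)
    have hρd : ∀ u, HasDerivAt ρ (genL (H u) (hH.1 u) (J u) (ρ u)) u := fun u => by
      simpa using (hU u).clm_apply (hasDerivAt_const u (V s x0))
    set σ : ℝ → Herm d := fun r => ρ r - c⁻¹ • z r with hσ
    have hσd : ∀ u, HasDerivAt σ (genL (H u) (hH.1 u) (J u) (σ u)) u := fun u => by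
      have := (hρd u).sub ((hz u).const_smul c⁻¹)
      rw [← map_smul, ← map_sub] at this
      exact this
    have hdens : ∀ R : Matrix (Fin d) (Fin d) ℂ, R.PosSemidef → R.trace.re = c →
        IsDensity (c⁻¹ • R) := by
      intro R hR hRc
      refine ⟨psd_smul hR (by positivity), ?_⟩
      rw [Matrix.trace_smul, psd_trace_eq hR, hRc]
      rw [Complex.real_smul, ← Complex.ofReal_mul, inv_mul_cancel₀ h0.ne', Complex.ofReal_one]
    have hσs : Herm.val (σ s) = c⁻¹ • Q := by
      show Herm.val (ρ s - c⁻¹ • z s) = _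
      rw [hρs, map_sub, map_smul, hPQ, hx0, Herm.val_mk, smul_sub, sub_sub_cancel]
    have key := hcontr s t hs hst (fun u => Herm.val (ρ u)) (fun u => Herm.val (σ u))
      (fun u _ i j => entry_hasDerivAt (hρd u) i j) (fun u _ i j => entry_hasDerivAt (hσd u) i j)
      (by
        show IsDensity (Herm.val (ρ s))
        rw [hρs]; exact hdens P hP rfl)
      (by
        show IsDensity (Herm.val (σ s))
        rw [hσs]; exact hdens Q hQ htr.symm)
    have hd : ∀ u, traceNorm (Herm.val (ρ u) - Herm.val (σ u)) = c⁻¹ * ‖z u‖ := by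
      intro u
      rw [← map_sub, ← Herm.norm_def]
      have : ρ u - σ u = c⁻¹ • z u := by simp [hσ]
      rw [this, norm_smul, Real.norm_of_nonneg (by positivity)]
    simp only [hd] at key
    have hci : 0 < c⁻¹ := by positivity
    refine le_of_mul_le_mul_left ?_ hci
    linarith

lemma contr_back {m : ℕ} {H : ℝ → Matrix (Fin d) (Fin d) ℂ} (hH : IsHamiltonianFamily H)
    {J : ℝ → Fin m → Matrix (Fin d) (Fin d) ℂ} {K γ : ℝ}
    (h : ∀ s t, 0 ≤ s → s ≤ t → ∀ y : ℝ → Herm d,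
      (∀ u, s ≤ u → HasDerivAt y (genL (H u) (hH.1 u) (J u) (y u)) u) → traceL (y s) = 0 →
      ‖y t‖ ≤ K * Real.exp (-γ * (t - s)) * ‖y s‖) :
    ExpContractiveWith (fun t x => gen (H t) (J t) x) K γ := by
  intro s t hs hst ρ σ hρ hσ hρd hσd
  have hM : IsSolution (fun t x => gen (H t) (J t) x) s (fun u => ρ u - σ u) := by
    intro u hu i j
    have e : gen (H u) (J u) (ρ u - σ u) = gen (H u) (J u) (ρ u) - gen (H u) (J u) (σ u) := by
      have := gen_add (H u) (J u) (ρ u - σ u) (σ u)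
      rw [sub_add_cancel] at this
      rw [this]; abel
    show HasDerivAt _ (gen (H u) (J u) (ρ u - σ u) i j) u
    rw [e]
    exact (hρ u hu i j).sub (hσ u hu i j)
  obtain ⟨h1, h2⟩ := solution_herm hH hM (hρd.1.isHermitian.sub hσd.1.isHermitian)
  have := h s t hs hst _ h1 (by
    rw [traceL_apply, h2 s le_rfl, Matrix.trace_sub, hρd.2, hσd.2]; simp)
  rwa [Herm.norm_def, Herm.norm_def, h2 s le_rfl, h2 t hst] at this

end Concrete


/-- a time-dependent Lindbladian staying within superoperator-norm distance
`ΔL < γ/(1 + ln K)` of an exponentially contractive one is itself exponentially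
contractive; in the case `K = 1` the new constants can be taken as `K̃ = 1`,
`γ̃ = γ - ΔL`. -/
theorem perturbed_lindbladian_contractive {d m m' : ℕ}
    (H H₂ : ℝ → Matrix (Fin d) (Fin d) ℂ)
    (J : ℝ → Fin m → Matrix (Fin d) (Fin d) ℂ)
    (J₂ : ℝ → Fin m' → Matrix (Fin d) (Fin d) ℂ)
    (hH : IsHamiltonianFamily H) (hH₂ : IsHamiltonianFamily H₂)
    (hJ : ∀ j i k, Continuous fun t => J t j i k)
    (hJ₂ : ∀ j i k, Continuous fun t => J₂ t j i k)
    (K γ : ℝ) (hK : 0 < K) (hγ : 0 < γ)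
    (hcontr : ExpContractiveWith
      (fun t x => hamTerm (H t) x + totalDissipator (J t) x) K γ)
    -- `ΔL = sup_{t ≥ 0} |||L̃_t - L_t|||` (expressed via an upper bound):
    (ΔL : ℝ) (hΔ0 : 0 ≤ ΔL)
    (hΔ : ∀ t, 0 ≤ t → ∀ x : Matrix (Fin d) (Fin d) ℂ,
      traceNorm ((hamTerm (H₂ t) x + totalDissipator (J₂ t) x) -
        (hamTerm (H t) x + totalDissipator (J t) x)) ≤ ΔL * traceNorm x)
    (hlt : ΔL < γ / (1 + Real.log K)) :
    ExpContractive (fun t x => hamTerm (H₂ t) x + totalDissipator (J₂ t) x) ∧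
    (K = 1 → ExpContractiveWith
      (fun t x => hamTerm (H₂ t) x + totalDissipator (J₂ t) x) 1 (γ - ΔL)) := by
  have hmain := abstract_main (continuous_genL hH hJ) (traceL (d := d))
    (A := fun t => genL (H t) (hH.1 t) (J t)) (B := fun t => genL (H₂ t) (hH₂.1 t) (J₂ t))
    (fun t x => by rw [traceL_apply, val_genL, trace_gen]; rfl)
    (fun t x => by rw [traceL_apply, val_genL, trace_gen]; rfl)
    (fun t x => gen_dissipative (hH.1 t) (J t) x.isHermitian)
    (fun t x => gen_dissipative (hH₂.1 t) (J₂ t) x.isHermitian)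
    hγ hΔ0 (contr_herm hH hJ hcontr)
    (fun t ht x => hΔ t ht (Herm.val x)) hlt
  obtain ⟨⟨K', γ', hK', hγ', h1⟩, h2⟩ := hmain
  exact ⟨⟨K', γ', hK', hγ', contr_back hH₂ h1⟩, fun hK1 => contr_back hH₂ (h2 hK1)⟩

end Paper
end

section
/- Let L_t be a time-dependent Lindbladian on M_d(ℂ) that is differentiable in t as a family of superoperators, and suppose there exist K_0, γ_0 > 0 such that for every fixed t_0 ≥ 0 the constant Lindbladian L_{t_0} is exponentially contractive with constants K_0 and γ_0. If sup_{t ≥ 0} |||d L_t/dt||| < (4/3)·γ_0² / (1 + (2/3)·ln K_0 + (1/3)·(ln K_0)²), where |||T||| := sup over nonzero x ∈ M_d(ℂ) of ‖T(x)‖₁/‖x‖₁, then the time-dependent Lindbladian L_t is exponentially contractive. -/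
open scoped ComplexOrder Kronecker
open Matrix

namespace Paper

section helpers

lemma exists_spec {d : ℕ} (A : Matrix (Fin d) (Fin d) ℂ) (hA : A.IsHermitian) :
    ∃ (V : Matrix (Fin d) (Fin d) ℂ) (l : Fin d → ℝ), Vᴴ * V = 1 ∧ V * Vᴴ = 1 ∧
      A = V * diagonal (fun i => (l i : ℂ)) * Vᴴ ∧ traceNorm A = ∑ i, |l i| := by
  have h1 : A = hA.eigenvectorUnitary.1 * diagonal (fun i => (hA.eigenvalues i : ℂ)) *
      (hA.eigenvectorUnitary.1)ᴴ := by
    conv_lhs => rw [hA.spectral_theorem, Unitary.conjStarAlgAut_apply]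
    rfl
  have hV1 : (hA.eigenvectorUnitary.1)ᴴ * hA.eigenvectorUnitary.1 = 1 :=
    Unitary.coe_star_mul_self hA.eigenvectorUnitary
  have hV2 : hA.eigenvectorUnitary.1 * (hA.eigenvectorUnitary.1)ᴴ = 1 :=
    Unitary.coe_mul_star_self hA.eigenvectorUnitary
  refine ⟨hA.eigenvectorUnitary.1, hA.eigenvalues, hV1, hV2, h1, ?_⟩
  generalize hA.eigenvectorUnitary.1 = V at *
  generalize hA.eigenvalues = l at *
  unfold traceNorm
  generalize_proofs hB
  have h2 : Aᴴ * A = V * (diagonal (fun i => ((l i ^ 2 : ℝ) : ℂ)) * Vᴴ) := by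
    rw [hA.eq]
    conv_lhs => rw [h1]
    calc _ = V * diagonal (fun i => (l i : ℂ)) * (Vᴴ * V) * diagonal (fun i => (l i : ℂ)) * Vᴴ := by
            simp only [Matrix.mul_assoc]
      _ = _ := by
            rw [hV1, Matrix.mul_one, Matrix.mul_assoc V, diagonal_mul_diagonal, Matrix.mul_assoc]
            congr 3
            ext i; push_cast; ring
  have h3 : (Aᴴ * A).charpoly.roots = Multiset.map (fun i => ((l i ^ 2 : ℝ) : ℂ)) Finset.univ.val := by
    rw [h2, Matrix.charpoly_mul_comm, Matrix.mul_assoc, hV1, Matrix.mul_one, charpoly_diagonal,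
      Polynomial.roots_prod]
    · simp only [Polynomial.roots_X_sub_C, Multiset.bind_singleton]
    · exact Finset.prod_ne_zero_iff.2 fun i _ => Polynomial.X_sub_C_ne_zero _
  rw [hB.roots_charpoly_eq_eigenvalues] at h3
  have h4 := congrArg (fun m => (Multiset.map (fun z : ℂ => Real.sqrt z.re) m).sum) h3
  simp only [Multiset.map_map, Function.comp_def] at h4
  have h5 : ∑ i, √(hB.eigenvalues i) = ∑ i, √(l i ^ 2) := by
    simpa [Finset.sum, ← Complex.ofReal_pow] using h4
  rw [h5]
  simp [Real.sqrt_sq_eq_abs]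

lemma tn_nonneg {d : ℕ} (A : Matrix (Fin d) (Fin d) ℂ) : 0 ≤ traceNorm A :=
  Finset.sum_nonneg fun _ _ => Real.sqrt_nonneg _

/-- duality, upper bound -/
lemma tn_ge {d : ℕ} {A U : Matrix (Fin d) (Fin d) ℂ} (hA : A.IsHermitian)
    (hU : U ∈ unitaryGroup (Fin d) ℂ) : ((U * A).trace).re ≤ traceNorm A := by
  obtain ⟨V, l, hV1, hV2, h1, h2⟩ := exists_spec A hA
  have hVU : V ∈ unitaryGroup (Fin d) ℂ := mem_unitaryGroup_iff.2 hV2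
  have hVU' : Vᴴ ∈ unitaryGroup (Fin d) ℂ := mem_unitaryGroup_iff.2 (by
    simpa [star_eq_conjTranspose] using hV1)
  have hW : Vᴴ * U * V ∈ unitaryGroup (Fin d) ℂ := mul_mem (mul_mem hVU' hU) hVU
  have : (U * A).trace = ∑ i, (Vᴴ * U * V) i i * (l i : ℂ) := by
    conv_lhs => rw [h1, ← Matrix.mul_assoc, Matrix.trace_mul_comm, ← Matrix.mul_assoc,
      ← Matrix.mul_assoc]
    simp [Matrix.trace, Matrix.mul_diagonal]
  rw [this, h2, Complex.re_sum]
  refine Finset.sum_le_sum fun i _ => (Complex.re_le_norm _).trans ?_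
  rw [norm_mul, Complex.norm_real, Real.norm_eq_abs]
  exact mul_le_of_le_one_left (abs_nonneg _) (entry_norm_bound_of_unitary hW i i)

lemma trace_conj_nonneg {d : ℕ} (V P : Matrix (Fin d) (Fin d) ℂ) (hP : P.PosSemidef)
    (l : Fin d → ℝ) (hl : ∀ i, 0 ≤ l i) :
    0 ≤ ((V * diagonal (fun i => (l i : ℂ)) * Vᴴ * P).trace).re := by
  have h : (V * diagonal (fun i => (l i : ℂ)) * Vᴴ * P).trace
      = ∑ i, (l i : ℂ) * (Vᴴ * P * V) i i := by
    rw [Matrix.mul_assoc, Matrix.mul_assoc, Matrix.trace_mul_comm, Matrix.mul_assoc]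
    simp [Matrix.trace, Matrix.diagonal_mul]
  rw [h, Complex.re_sum]
  refine Finset.sum_nonneg fun i _ => ?_
  rw [Complex.re_ofReal_mul]
  have := (hP.conjTranspose_mul_mul_same V).diag_nonneg (i := i)
  exact mul_nonneg (hl i) (Complex.le_def.1 this).1

/-- sign / Jordan decomposition -/
lemma exists_sign {d : ℕ} (A : Matrix (Fin d) (Fin d) ℂ) (hA : A.IsHermitian) :
    ∃ S P N : Matrix (Fin d) (Fin d) ℂ, S ∈ unitaryGroup (Fin d) ℂ ∧
      P.PosSemidef ∧ N.PosSemidef ∧ A = P - N ∧ S * A = P + N ∧ A * S = P + N ∧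
      ((S * A).trace).re = traceNorm A ∧
      (∀ Q : Matrix (Fin d) (Fin d) ℂ, Q.PosSemidef → ((S * Q).trace).re ≤ (Q.trace).re) ∧
      (∀ Q : Matrix (Fin d) (Fin d) ℂ, Q.PosSemidef → -((S * Q).trace).re ≤ (Q.trace).re) := by
  obtain ⟨V, l, hV1, hV2, h1, h2⟩ := exists_spec A hA
  set sg : Fin d → ℝ := fun i => if 0 ≤ l i then 1 else -1 with hsg
  have hsg2 : ∀ i, sg i * sg i = 1 := fun i => by simp only [hsg]; split_ifs <;> norm_num
  have habs : ∀ i, sg i * l i = |l i| := fun i => by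
    simp only [hsg]; split_ifs with h
    · rw [abs_of_nonneg h, one_mul]
    · rw [abs_of_neg (not_le.1 h)]; ring
  set D : (Fin d → ℝ) → Matrix (Fin d) (Fin d) ℂ :=
    fun f => V * diagonal (fun i => (f i : ℂ)) * Vᴴ with hD
  have hmul : ∀ f g, D f * D g = D (fun i => f i * g i) := fun f g => by
    simp only [hD]
    calc _ = V * diagonal (fun i => (f i : ℂ)) * (Vᴴ * V) * diagonal (fun i => (g i : ℂ)) * Vᴴ := by
            simp only [Matrix.mul_assoc]
      _ = _ := by
            rw [hV1, Matrix.mul_one, Matrix.mul_assoc V, diagonal_mul_diagonal]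
            simp
  have hadd : ∀ f g, D f + D g = D (fun i => f i + g i) := fun f g => by
    simp only [hD]
    rw [← Matrix.add_mul, ← Matrix.mul_add, diagonal_add]
    simp
  have hsub : ∀ f g, D f - D g = D (fun i => f i - g i) := fun f g => by
    simp only [hD]
    rw [← Matrix.sub_mul, ← Matrix.mul_sub, diagonal_sub]
    simp
  have hone : D (fun _ => 1) = 1 := by simp [hD, hV2]
  have hstar : ∀ f, (D f)ᴴ = D f := fun f => by
    simp only [hD, conjTranspose_mul, conjTranspose_conjTranspose, diagonal_conjTranspose,
      Matrix.mul_assoc]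
    congr 3
    ext i; simp
  have hpsd : ∀ f : Fin d → ℝ, (∀ i, 0 ≤ f i) → (D f).PosSemidef := fun f hf => by
    simp only [hD]
    apply PosSemidef.mul_mul_conjTranspose_same
    apply PosSemidef.diagonal
    intro i; simpa using hf i
  have hSA : D sg * A = D (fun i => max (l i) 0) + D (fun i => max (- l i) 0) := by
    rw [show A = D l from h1, hmul, hadd]
    congr 1; ext i; rw [habs]
    rcases le_total 0 (l i) with h | h
    · rw [abs_of_nonneg h, max_eq_left h, max_eq_right (by linarith)]; ring
    · rw [abs_of_nonpos h, max_eq_right h, max_eq_left (by linarith)]; ring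
  have hAS : A * D sg = D sg * A := by
    rw [show A = D l from h1, hmul, hmul]
    congr 1; ext i; ring
  have htr : ∀ f, (D f).trace = ∑ i, (f i : ℂ) := fun f => by
    simp only [hD]
    rw [Matrix.trace_mul_comm, ← Matrix.mul_assoc, hV1, Matrix.one_mul]
    simp [Matrix.trace]
  refine ⟨D sg, D (fun i => max (l i) 0), D (fun i => max (- l i) 0), ?_, ?_, ?_, ?_, hSA,
    hAS.trans hSA, ?_, ?_, ?_⟩
  · rw [mem_unitaryGroup_iff, star_eq_conjTranspose, hstar, hmul]
    simp only [hsg2]; exact hone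
  · exact hpsd _ fun i => le_max_right _ _
  · exact hpsd _ fun i => le_max_right _ _
  · rw [hsub]; conv_lhs => rw [show A = D l from h1]
    congr 1; ext i
    rcases le_total 0 (l i) with h | h
    · rw [max_eq_left h, max_eq_right (by linarith)]; ring
    · rw [max_eq_right h, max_eq_left (by linarith)]; ring
  · rw [show A = D l from h1, hmul, htr] 
    rw [show D l = A from h1.symm, h2]
    simp [habs, -Complex.ofReal_sum]
  · intro Q hQ
    have := trace_conj_nonneg V Q hQ (fun i => 1 - sg i) (fun i => by
      simp only [hsg]; split_ifs <;> norm_num)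
    change 0 ≤ ((D (fun i => 1 - sg i) * Q).trace).re at this
    rw [← hsub, hone, Matrix.sub_mul, Matrix.one_mul, Matrix.trace_sub, Complex.sub_re] at this
    linarith
  · intro Q hQ
    have := trace_conj_nonneg V Q hQ (fun i => 1 + sg i) (fun i => by
      simp only [hsg]; split_ifs <;> norm_num)
    change 0 ≤ ((D (fun i => 1 + sg i) * Q).trace).re at this
    rw [← hadd, hone, Matrix.add_mul, Matrix.one_mul, Matrix.trace_add, Complex.add_re] at this
    linarith

lemma tn_exists {d : ℕ} (A : Matrix (Fin d) (Fin d) ℂ) (hA : A.IsHermitian) :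
    ∃ S ∈ unitaryGroup (Fin d) ℂ, ((S * A).trace).re = traceNorm A := by
  obtain ⟨S, P, N, hS, -, -, -, -, -, h, -⟩ := exists_sign A hA
  exact ⟨S, hS, h⟩

lemma tn_add_le {d : ℕ} {A B : Matrix (Fin d) (Fin d) ℂ} (hA : A.IsHermitian)
    (hB : B.IsHermitian) : traceNorm (A + B) ≤ traceNorm A + traceNorm B := by
  obtain ⟨S, hS, h⟩ := tn_exists (A + B) (hA.add hB)
  rw [← h, Matrix.mul_add, Matrix.trace_add, Complex.add_re]
  exact add_le_add (tn_ge hA hS) (tn_ge hB hS)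

lemma tn_smul_le {d : ℕ} {A : Matrix (Fin d) (Fin d) ℂ} (hA : A.IsHermitian) (c : ℝ) (hc : 0 ≤ c) :
    traceNorm ((c : ℂ) • A) ≤ c * traceNorm A := by
  have hcA : ((c : ℂ) • A).IsHermitian := by
    unfold Matrix.IsHermitian; rw [conjTranspose_smul, hA.eq]; simp
  obtain ⟨S, hS, h⟩ := tn_exists _ hcA
  rw [← h, Matrix.mul_smul, Matrix.trace_smul, smul_eq_mul, Complex.re_ofReal_mul]
  exact mul_le_mul_of_nonneg_left (tn_ge hA hS) hc

lemma tn_smul {d : ℕ} {A : Matrix (Fin d) (Fin d) ℂ} (hA : A.IsHermitian) (c : ℝ) (hc : 0 ≤ c) :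
    traceNorm ((c : ℂ) • A) = c * traceNorm A := by
  refine le_antisymm (tn_smul_le hA c hc) ?_
  obtain ⟨S, hS, h⟩ := tn_exists _ hA
  have hcA : ((c : ℂ) • A).IsHermitian := by
    unfold Matrix.IsHermitian; rw [conjTranspose_smul, hA.eq]; simp
  have := tn_ge hcA hS
  rwa [Matrix.mul_smul, Matrix.trace_smul, smul_eq_mul, Complex.re_ofReal_mul, h] at this

lemma tn_zero {d : ℕ} : traceNorm (0 : Matrix (Fin d) (Fin d) ℂ) = 0 := by
  obtain ⟨S, hS, h⟩ := tn_exists (0 : Matrix (Fin d) (Fin d) ℂ) (by simp)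
  rw [← h]; simp

lemma tn_eq_zero {d : ℕ} {A : Matrix (Fin d) (Fin d) ℂ} (hA : A.IsHermitian)
    (h : traceNorm A ≤ 0) : A = 0 := by
  obtain ⟨V, l, hV1, hV2, h1, h2⟩ := exists_spec A hA
  have h0 : ∑ i, |l i| = 0 := le_antisymm (h2 ▸ h) (Finset.sum_nonneg fun _ _ => abs_nonneg _)
  rw [Finset.sum_eq_zero_iff_of_nonneg (fun _ _ => abs_nonneg _)] at h0
  have : l = 0 := by ext i; simpa using h0 i (Finset.mem_univ i)
  rw [h1, this]; simp

lemma tn_neg {d : ℕ} {A : Matrix (Fin d) (Fin d) ℂ} (hA : A.IsHermitian) :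
    traceNorm (-A) = traceNorm A := by
  have key : ∀ B : Matrix (Fin d) (Fin d) ℂ, B.IsHermitian → traceNorm (-B) ≤ traceNorm B := by
    intro B hB
    obtain ⟨S, hS, h⟩ := tn_exists (-B) hB.neg
    have hS' : -S ∈ unitaryGroup (Fin d) ℂ := by
      rw [mem_unitaryGroup_iff] at *; simpa using hS
    rw [← h, Matrix.mul_neg, ← Matrix.neg_mul]
    exact tn_ge hB hS'
  refine le_antisymm (key A hA) ?_
  simpa using key (-A) hA.neg

lemma tn_le_sum {d : ℕ} {A : Matrix (Fin d) (Fin d) ℂ} (hA : A.IsHermitian) :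
    traceNorm A ≤ ∑ i, ∑ j, ‖A j i‖ := by
  obtain ⟨S, hS, h⟩ := tn_exists A hA
  rw [← h, Matrix.trace, Complex.re_sum]
  refine Finset.sum_le_sum fun i _ => ?_
  rw [Matrix.diag_apply, Matrix.mul_apply, Complex.re_sum]
  refine Finset.sum_le_sum fun j _ => (Complex.re_le_norm _).trans ?_
  rw [norm_mul]
  exact mul_le_of_le_one_left (norm_nonneg _) (entry_norm_bound_of_unitary hS i j)

/-- dissipativity of the Lindbladian -/
lemma dissipative {d m : ℕ} (H : Matrix (Fin d) (Fin d) ℂ) (J : Fin m → Matrix (Fin d) (Fin d) ℂ)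
    (A : Matrix (Fin d) (Fin d) ℂ) (hA : A.IsHermitian) :
    ∃ S ∈ unitaryGroup (Fin d) ℂ, ((S * A).trace).re = traceNorm A ∧
      ((S * (hamTerm H A + totalDissipator J A)).trace).re ≤ 0 := by
  obtain ⟨S, P, N, hS, hP, hN, hPN, hSA, hAS, htr, hu, hl⟩ := exists_sign A hA
  refine ⟨S, hS, htr, ?_⟩
  have hham : (S * hamTerm H A).trace = 0 := by
    unfold hamTerm
    rw [Matrix.mul_smul, Matrix.trace_smul, Matrix.mul_sub, Matrix.trace_sub]
    have e1 : (S * (H * A)).trace = ((P + N) * H).trace := by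
      rw [← Matrix.mul_assoc, Matrix.trace_mul_comm, ← Matrix.mul_assoc, hAS]
    have e2 : (S * (A * H)).trace = ((P + N) * H).trace := by
      rw [← Matrix.mul_assoc, hSA]
    rw [e1, e2]; simp
  have hdis : ∀ j, ((S * dissipator (J j) A).trace).re ≤ 0 := by
    intro j
    set L := J j
    unfold dissipator
    have e1 : (S * (Lᴴ * L * A)).trace = (L * P * Lᴴ).trace + (L * N * Lᴴ).trace := by
      rw [Matrix.trace_mul_comm, Matrix.mul_assoc, hAS, Matrix.mul_add, Matrix.trace_add,
        Matrix.mul_assoc, Matrix.trace_mul_comm, Matrix.mul_assoc Lᴴ, Matrix.trace_mul_comm _ (L * N)]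
    have e2 : (S * (A * (Lᴴ * L))).trace = (L * P * Lᴴ).trace + (L * N * Lᴴ).trace := by
      rw [← Matrix.mul_assoc, hSA, Matrix.add_mul, Matrix.trace_add,
        Matrix.trace_mul_comm, Matrix.trace_mul_comm N, Matrix.mul_assoc, Matrix.trace_mul_comm,
         Matrix.mul_assoc Lᴴ, Matrix.trace_mul_comm _ (L * N)]
    have e3 : (S * (L * A * Lᴴ)).trace = (S * (L * P * Lᴴ)).trace - (S * (L * N * Lᴴ)).trace := by
      rw [hPN, Matrix.mul_sub, Matrix.sub_mul, Matrix.mul_sub, Matrix.trace_sub]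
    rw [Matrix.mul_sub, Matrix.mul_smul, Matrix.mul_add, Matrix.trace_sub, Matrix.trace_smul,
      Matrix.trace_add, e1, e2, e3]
    have h1 := hu _ (hP.mul_mul_conjTranspose_same L)
    have h2 := hl _ (hN.mul_mul_conjTranspose_same L)
    have : ((1:ℂ)/2) • ((L * P * Lᴴ).trace + (L * N * Lᴴ).trace + ((L * P * Lᴴ).trace + (L * N * Lᴴ).trace))
      = (L * P * Lᴴ).trace + (L * N * Lᴴ).trace := by rw [smul_eq_mul]; ring
    rw [this]
    simp only [Complex.sub_re, Complex.add_re]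
    linarith
  unfold totalDissipator
  rw [Matrix.mul_add, Matrix.trace_add, hham, zero_add, Matrix.mul_sum, Matrix.trace_sum,
    Complex.re_sum]
  exact Finset.sum_nonpos fun j _ => hdis j

lemma lind_trace {d m : ℕ} (H : Matrix (Fin d) (Fin d) ℂ) (J : Fin m → Matrix (Fin d) (Fin d) ℂ)
    (A : Matrix (Fin d) (Fin d) ℂ) : (hamTerm H A + totalDissipator J A).trace = 0 := by
  unfold hamTerm totalDissipator dissipator
  rw [Matrix.trace_add, Matrix.trace_sum, Matrix.trace_smul, Matrix.trace_sub,
    Matrix.trace_mul_comm A H, sub_self, smul_zero, zero_add]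
  refine Finset.sum_eq_zero fun j _ => ?_
  rw [Matrix.trace_sub, Matrix.trace_smul, Matrix.trace_add, Matrix.trace_mul_comm A,
    Matrix.mul_assoc, Matrix.trace_mul_comm, Matrix.mul_assoc,  Matrix.trace_mul_comm,
    Matrix.mul_assoc (J j)ᴴ, Matrix.trace_mul_comm (J j)ᴴ, smul_eq_mul]
  ring

lemma lind_star {d m : ℕ} (H : Matrix (Fin d) (Fin d) ℂ) (J : Fin m → Matrix (Fin d) (Fin d) ℂ)
    (hH : H.IsHermitian)
    (A : Matrix (Fin d) (Fin d) ℂ) : (hamTerm H A + totalDissipator J A)ᴴ =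
      hamTerm H Aᴴ + totalDissipator J Aᴴ := by
  unfold hamTerm totalDissipator dissipator
  rw [conjTranspose_add, conjTranspose_sum]
  congr 1
  · simp only [conjTranspose_smul, conjTranspose_sub, conjTranspose_mul, hH.eq]
    simp [smul_sub]; abel
  · refine Finset.sum_congr rfl fun j _ => ?_
    simp only [conjTranspose_smul, conjTranspose_sub, conjTranspose_mul, conjTranspose_add,
      conjTranspose_conjTranspose, Matrix.mul_assoc]
    simp [add_comm]

/-- Lindbladian as a real-linear map -/
noncomputable def lindL {d m : ℕ} (H : Matrix (Fin d) (Fin d) ℂ)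
    (J : Fin m → Matrix (Fin d) (Fin d) ℂ) :
    Matrix (Fin d) (Fin d) ℂ →ₗ[ℂ] Matrix (Fin d) (Fin d) ℂ where
  toFun x := hamTerm H x + totalDissipator J x
  map_add' x y := by
    unfold hamTerm totalDissipator dissipator
    simp only [Matrix.mul_add, Matrix.add_mul, smul_add, smul_sub, Finset.sum_add_distrib,
      Finset.sum_sub_distrib]
    abel
  map_smul' c x := by
    unfold hamTerm totalDissipator dissipator
    simp only [Matrix.mul_smul, Matrix.smul_mul, smul_add, smul_sub, Finset.sum_add_distrib,
      Finset.sum_sub_distrib, Finset.smul_sum, RingHom.id_apply, smul_comm c]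

lemma lindL_apply {d m : ℕ} (H : Matrix (Fin d) (Fin d) ℂ)
    (J : Fin m → Matrix (Fin d) (Fin d) ℂ) (x) : lindL H J x = hamTerm H x + totalDissipator J x :=
  rfl

attribute [local instance] Matrix.normedAddCommGroup Matrix.normedSpace

/-- the uniform structure coming from the entrywise sup norm -/
@[reducible] noncomputable def matUnif (d : ℕ) : UniformSpace (Matrix (Fin d) (Fin d) ℂ) :=
  PseudoMetricSpace.toUniformSpace

/-- the topology coming from the entrywise sup norm -/
@[reducible] noncomputable def matTop (d : ℕ) : TopologicalSpace (Matrix (Fin d) (Fin d) ℂ) :=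
  (PseudoMetricSpace.toUniformSpace (α := Matrix (Fin d) (Fin d) ℂ)).toTopologicalSpace

attribute [local instance] matUnif matTop

lemma hasDerivAt_mat {d : ℕ} {y : ℝ → Matrix (Fin d) (Fin d) ℂ} {y' : Matrix (Fin d) (Fin d) ℂ}
    {t : ℝ} : HasDerivAt y y' t ↔ ∀ i j, HasDerivAt (fun u => y u i j) (y' i j) t := by
  refine (hasDerivAt_pi (φ := y) (φ' := y')).trans (forall_congr' fun i => ?_)
  exact (hasDerivAt_pi (φ := fun u => y u i) (φ' := y' i))

/-- real part of the trace pairing -/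
noncomputable def trL {d : ℕ} (U : Matrix (Fin d) (Fin d) ℂ) :
    Matrix (Fin d) (Fin d) ℂ →ₗ[ℝ] ℝ where
  toFun A := ((U * A).trace).re
  map_add' A B := by simp [Matrix.mul_add]
  map_smul' c A := by simp

lemma hasDerivAt_tr {d : ℕ} {y : ℝ → Matrix (Fin d) (Fin d) ℂ} {y' : Matrix (Fin d) (Fin d) ℂ}
    {t : ℝ} (h : HasDerivAt y y' t) (U : Matrix (Fin d) (Fin d) ℂ) :
    HasDerivAt (fun u => ((U * y u).trace).re) ((U * y').trace).re t :=
  (LinearMap.toContinuousLinearMap (trL U)).hasFDerivAt.comp_hasDerivAt t h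

lemma deriv_compare {h h' B B' : ℝ → ℝ} {a b : ℝ} (hab : a ≤ b)
    (hh : ∀ x ∈ Set.Icc a b, HasDerivAt h (h' x) x)
    (hB : ∀ x ∈ Set.Icc a b, HasDerivAt B (B' x) x)
    (hle : ∀ x ∈ Set.Icc a b, h' x ≤ B' x) : h b - h a ≤ B b - B a := by
  have := image_le_of_deriv_right_le_deriv_boundary (f := h) (f' := h') (a := a) (b := b)
    (B := fun x => B x - B a + h a) (B' := B')
    (fun x hx => (hh x hx).continuousAt.continuousWithinAt)
    (fun x hx => (hh x ⟨hx.1, hx.2.le⟩).hasDerivWithinAt) (by simp)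
    (fun x hx => (((hB x hx).sub_const (B a)).add_const (h a)).continuousAt.continuousWithinAt)
    (fun x hx => (((hB x ⟨hx.1, hx.2.le⟩).sub_const (B a)).add_const (h a)).hasDerivWithinAt)
    (fun x hx => hle x ⟨hx.1, hx.2.le⟩) (Set.right_mem_Icc.2 hab)
  linarith

lemma tn_continuousOn {d : ℕ} {y : ℝ → Matrix (Fin d) (Fin d) ℂ} {s : Set ℝ}
    (hy : ContinuousOn y s) (hh : ∀ t ∈ s, (y t).IsHermitian) :
    ContinuousOn (fun t => traceNorm (y t)) s := by
  intro t ht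
  have hent : ∀ i j, Filter.Tendsto (fun u => ‖y u j i - y t j i‖) (nhdsWithin t s) (nhds 0) := by
    intro i j
    have h1 := hy t ht
    have h2 : ContinuousWithinAt (fun u => y u j i) s t :=
      (continuous_apply_apply (ρ := fun _ _ => ℂ) j i).continuousAt.comp_continuousWithinAt h1
    exact tendsto_iff_norm_sub_tendsto_zero.1 h2
  have hsum : Filter.Tendsto (fun u => ∑ i, ∑ j, ‖y u j i - y t j i‖) (nhdsWithin t s) (nhds 0) := by
    have := tendsto_finsetSum (Finset.univ : Finset (Fin d)) (fun i _ =>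
      tendsto_finsetSum (Finset.univ : Finset (Fin d)) (fun j _ => hent i j))
    simpa using this
  refine tendsto_iff_norm_sub_tendsto_zero.2 ?_
  refine squeeze_zero' (Filter.Eventually.of_forall fun _ => norm_nonneg _) ?_ hsum
  filter_upwards [self_mem_nhdsWithin] with u hu
  have hd := (hh u hu).sub (hh t ht)
  have h1 := tn_le_sum hd
  have h2 := tn_add_le hd (hh t ht)
  have h3 := tn_add_le hd.neg (hh u hu)
  rw [tn_neg hd] at h3
  simp only [sub_add_cancel, neg_sub] at h2 h3
  simp only [Matrix.sub_apply] at h1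
  rw [Real.norm_eq_abs, abs_le]
  constructor <;> linarith

/-- contraction of the trace norm along Hermitian solutions -/
lemma herm_contr {d m : ℕ} (H : ℝ → Matrix (Fin d) (Fin d) ℂ)
    (J : ℝ → Fin m → Matrix (Fin d) (Fin d) ℂ) (y : ℝ → Matrix (Fin d) (Fin d) ℂ) {s T : ℝ}
    (hsT : s ≤ T) (hsol : ∀ t, s ≤ t → HasDerivAt y (lindL (H t) (J t) (y t)) t)
    (hy : ∀ t, s ≤ t → (y t).IsHermitian) : traceNorm (y T) ≤ traceNorm (y s) := by
  have hcont : ContinuousOn (fun t => traceNorm (y t)) (Set.Ici s) :=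
    tn_continuousOn (fun t ht => (hsol t ht).continuousAt.continuousWithinAt) hy
  have hF : ContinuousOn (fun r => - traceNorm (y (T - r))) (Set.Icc 0 (T - s)) := by
    refine ContinuousOn.neg (hcont.comp (by fun_prop) ?_)
    intro r hr
    simp only [Set.mem_Icc, Set.mem_Ici] at *
    linarith
  have key := image_le_of_liminf_slope_right_le_deriv_boundary hF
    (B := fun _ => - traceNorm (y T)) (B' := fun _ => 0) (by simp) continuousOn_const
    (fun x _ => hasDerivWithinAt_const _ _ _) ?_ (Set.right_mem_Icc.2 (by linarith))
  · simp only [sub_sub_cancel] at key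
    linarith
  intro r hr ε hε
  have hr1 : s ≤ T - r := by linarith [hr.2]
  obtain ⟨S, hS, hS1, hS2⟩ := dissipative (H (T - r)) (J (T - r)) (y (T - r)) (hy _ hr1)
  have hφ : HasDerivAt (fun z => - ((S * y (T - z)).trace).re)
      ((S * (lindL (H (T - r)) (J (T - r)) (y (T - r)))).trace).re r := by
    have h0 := hasDerivAt_tr (hsol _ hr1) S
    have h1 := (h0.comp_const_sub T r).neg
    rw [neg_neg] at h1
    exact h1
  have hlt : ((S * (lindL (H (T - r)) (J (T - r)) (y (T - r)))).trace).re < ε :=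
    lt_of_le_of_lt hS2 hε
  have hev := hφ.hasDerivWithinAt.limsup_slope_le' (s := Set.Ioi r) (by simp) hlt
  refine Filter.Eventually.frequently ?_
  have hev2 : ∀ᶠ z in nhdsWithin r (Set.Ioi r), z ∈ Set.Ioo r (T - s) :=
    Ioo_mem_nhdsGT hr.2
  filter_upwards [hev, hev2] with z hz hz2
  refine lt_of_le_of_lt ?_ hz
  rw [slope_def_field, slope_def_field]
  have hzr : 0 < z - r := by linarith [hz2.1]
  have := tn_ge (hy (T - z) (by linarith [hz2.2])) hS
  gcongr ?_ / _
  rw [hS1]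
  linarith

lemma trace_pres {d m : ℕ} (H : ℝ → Matrix (Fin d) (Fin d) ℂ)
    (J : ℝ → Fin m → Matrix (Fin d) (Fin d) ℂ) (y : ℝ → Matrix (Fin d) (Fin d) ℂ) {s : ℝ}
    (hsol : ∀ t, s ≤ t → HasDerivAt y (lindL (H t) (J t) (y t)) t)
    (hy : (y s).trace = 0) : ∀ t, s ≤ t → (y t).trace = 0 := by
  intro t hst
  have hd : ∀ u, s ≤ u → HasDerivAt (fun u => (y u).trace) 0 u := by
    intro u hu
    have h1 := hasDerivAt_mat.1 (hsol u hu)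
    have h2 : HasDerivAt (fun u => (y u).trace) (lindL (H u) (J u) (y u)).trace u := by
      simp only [Matrix.trace, Matrix.diag_apply]
      exact HasDerivAt.fun_sum fun i _ => h1 i i
    rwa [lindL_apply, lind_trace] at h2
  have := constant_of_has_deriv_right_zero (a := s) (b := t) (f := fun u => (y u).trace)
    (fun u hu => (hd u hu.1).continuousAt.continuousWithinAt)
    (fun u hu => (hd u hu.1).hasDerivWithinAt) t (Set.right_mem_Icc.2 hst)
  simpa [hy] using this

lemma herm_pres {d m : ℕ} (H : ℝ → Matrix (Fin d) (Fin d) ℂ)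
    (J : ℝ → Fin m → Matrix (Fin d) (Fin d) ℂ) (hH : ∀ t, (H t).IsHermitian)
    (y : ℝ → Matrix (Fin d) (Fin d) ℂ) {s : ℝ}
    (hsol : ∀ t, s ≤ t → HasDerivAt y (lindL (H t) (J t) (y t)) t)
    (hy : (y s).IsHermitian) : ∀ t, s ≤ t → (y t).IsHermitian := by
  intro t hst
  set a : ℝ → Matrix (Fin d) (Fin d) ℂ := fun u => Complex.I • (y u - (y u)ᴴ) with ha
  have hah : ∀ u, (a u).IsHermitian := by
    intro u
    unfold Matrix.IsHermitian
    simp only [ha, conjTranspose_smul, conjTranspose_sub, conjTranspose_conjTranspose]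
    simp [smul_sub]
    abel
  have hasol : ∀ u, s ≤ u → HasDerivAt a (lindL (H u) (J u) (a u)) u := by
    intro u hu
    have h1 := hasDerivAt_mat.1 (hsol u hu)
    rw [hasDerivAt_mat]
    intro i j
    have e : lindL (H u) (J u) (a u) =
        Complex.I • (lindL (H u) (J u) (y u) - (lindL (H u) (J u) (y u))ᴴ) := by
      simp only [ha, map_smul, map_sub]
      rw [lindL_apply _ _ (y u), lind_star _ _ (hH u), ← lindL_apply, ← lindL_apply]
    rw [e]
    simp only [ha, Matrix.smul_apply, Matrix.sub_apply, conjTranspose_apply]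
    exact ((h1 i j).sub (h1 j i).star).const_smul Complex.I
  have h := herm_contr H J a hst hasol (fun u _ => hah u)
  have has : a s = 0 := by simp [ha, hy.eq]
  rw [has, tn_zero] at h
  have h0 := tn_eq_zero (hah t) h
  simp only [ha, smul_eq_zero, Complex.I_ne_zero, false_or, sub_eq_zero] at h0
  exact h0.symm

/-- frozen generator as a continuous linear map -/
noncomputable def Lc {d m : ℕ} (H : Matrix (Fin d) (Fin d) ℂ)
    (J : Fin m → Matrix (Fin d) (Fin d) ℂ) :
    Matrix (Fin d) (Fin d) ℂ →L[ℝ] Matrix (Fin d) (Fin d) ℂ :=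
  LinearMap.toContinuousLinearMap ((lindL H J).restrictScalars ℝ)

/-- frozen semigroup -/
noncomputable def Ex {d m : ℕ} (H : Matrix (Fin d) (Fin d) ℂ)
    (J : Fin m → Matrix (Fin d) (Fin d) ℂ) (v : ℝ) :
    Matrix (Fin d) (Fin d) ℂ →L[ℝ] Matrix (Fin d) (Fin d) ℂ :=
  NormedSpace.exp (v • Lc H J)

lemma Ex_zero {d m : ℕ} (H : Matrix (Fin d) (Fin d) ℂ)
    (J : Fin m → Matrix (Fin d) (Fin d) ℂ) (z) : Ex H J 0 z = z := by
  simp [Ex, NormedSpace.exp_zero]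

lemma Ex_deriv' {d m : ℕ} (H : Matrix (Fin d) (Fin d) ℂ)
    (J : Fin m → Matrix (Fin d) (Fin d) ℂ) (v : ℝ) :
    HasDerivAt (Ex H J) (Ex H J v * Lc H J) v :=
  hasDerivAt_exp_smul_const (𝕂 := ℝ) (Lc H J) v

lemma Ex_deriv {d m : ℕ} (H : Matrix (Fin d) (Fin d) ℂ)
    (J : Fin m → Matrix (Fin d) (Fin d) ℂ) (z) (v : ℝ) :
    HasDerivAt (fun v => Ex H J v z) (lindL H J (Ex H J v z)) v := by
  have h := hasDerivAt_exp_smul_const' (𝕂 := ℝ) (Lc H J) v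
  have := h.clm_apply (hasDerivAt_const v z)
  rw [map_zero, add_zero] at this
  exact this

lemma Ex_herm {d m : ℕ} (H : Matrix (Fin d) (Fin d) ℂ)
    (J : Fin m → Matrix (Fin d) (Fin d) ℂ) (hH : H.IsHermitian) {z : Matrix (Fin d) (Fin d) ℂ}
    (hz : z.IsHermitian) {v : ℝ} (hv : 0 ≤ v) : (Ex H J v z).IsHermitian :=
  herm_pres (fun _ => H) (fun _ => J) (fun _ => hH) (fun v => Ex H J v z) (s := 0)
    (fun t _ => Ex_deriv H J z t) (by simpa [Ex_zero] using hz) v hv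

lemma Ex_contr {d m : ℕ} (H : Matrix (Fin d) (Fin d) ℂ)
    (J : Fin m → Matrix (Fin d) (Fin d) ℂ) (hH : H.IsHermitian) {z : Matrix (Fin d) (Fin d) ℂ}
    (hz : z.IsHermitian) {v : ℝ} (hv : 0 ≤ v) : traceNorm (Ex H J v z) ≤ traceNorm z := by
  have := herm_contr (fun _ => H) (fun _ => J) (fun v => Ex H J v z) hv
    (fun t _ => Ex_deriv H J z t) (fun t ht => Ex_herm H J hH hz ht)
  simpa [Ex_zero] using this

lemma Ex_decay {d m : ℕ} (H : Matrix (Fin d) (Fin d) ℂ)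
    (J : Fin m → Matrix (Fin d) (Fin d) ℂ) (hH : H.IsHermitian) {K γ : ℝ}
    (hc : ExpContractiveWith (fun _ x => hamTerm H x + totalDissipator J x) K γ)
    {z : Matrix (Fin d) (Fin d) ℂ}
    (hz : z.IsHermitian) (hz0 : z.trace = 0) {v : ℝ} (hv : 0 ≤ v) :
    traceNorm (Ex H J v z) ≤ K * Real.exp (-γ * v) * traceNorm z := by
  obtain ⟨S, P, N, hS, hP, hN, hPN, -⟩ := exists_sign z hz
  have htr : P.trace = N.trace := by
    rw [hPN, Matrix.trace_sub, sub_eq_zero] at hz0; exact hz0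
  by_cases h0 : P.trace = 0
  · have hP0 := hP.trace_eq_zero_iff.1 h0
    have hN0 := hN.trace_eq_zero_iff.1 (htr ▸ h0)
    have : z = 0 := by rw [hPN, hP0, hN0, sub_zero]
    rw [this, map_zero, tn_zero]; simp
  have hPt : 0 ≤ P.trace := hP.trace_nonneg
  set c : ℝ := P.trace.re with hcdef
  have hcP : P.trace = (c : ℂ) := by
    apply Complex.ext
    · simp [hcdef]
    · simpa using (Complex.le_def.1 hPt).2.symm
  have hc0 : 0 ≤ c := (Complex.le_def.1 hPt).1
  have hcne : c ≠ 0 := by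
    intro h; apply h0; rw [hcP, h]; simp
  have hcC : (c : ℂ) ≠ 0 := by exact_mod_cast hcne
  have hdens : ∀ Q : Matrix (Fin d) (Fin d) ℂ, Q.PosSemidef → Q.trace = (c : ℂ) →
      IsDensity (((c⁻¹ : ℝ) : ℂ) • Q) := by
    intro Q hQ hQt
    refine ⟨hQ.smul (by exact_mod_cast inv_nonneg.2 hc0), ?_⟩
    rw [Matrix.trace_smul, hQt, smul_eq_mul]
    push_cast
    exact inv_mul_cancel₀ hcC
  have hsolE : ∀ x, IsSolution (fun _ x => hamTerm H x + totalDissipator J x) 0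
      (fun v => Ex H J v x) := by
    intro x t _
    exact hasDerivAt_mat.1 (Ex_deriv H J x t)
  have key := hc 0 v le_rfl hv (fun v => Ex H J v (((c⁻¹ : ℝ) : ℂ) • P))
    (fun v => Ex H J v (((c⁻¹ : ℝ) : ℂ) • N)) (hsolE _) (hsolE _)
    (by simpa only [Ex_zero] using hdens P hP hcP)
    (by simpa only [Ex_zero] using hdens N hN (htr ▸ hcP))
  have hreal : ∀ A : Matrix (Fin d) (Fin d) ℂ, ((c⁻¹ : ℝ) : ℂ) • A = (c⁻¹ : ℝ) • A := by
    intro A; ext i j; simp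
  simp only [Ex_zero, sub_zero] at key
  rw [← map_sub, ← smul_sub, ← hPN, tn_smul hz _ (inv_nonneg.2 hc0), hreal, map_smul, ← hreal,
    tn_smul (Ex_herm H J hH hz hv) _ (inv_nonneg.2 hc0)] at key
  have hci : 0 < c⁻¹ := inv_pos.2 (lt_of_le_of_ne hc0 (Ne.symm hcne))
  have : c⁻¹ * traceNorm (Ex H J v z) ≤ c⁻¹ * (K * Real.exp (-γ * v) * traceNorm z) := by
    linarith
  exact le_of_mul_le_mul_left this hci

lemma exp_neg_le_quad {x : ℝ} (hx : 0 ≤ x) : Real.exp (-x) ≤ 1 - x + x ^ 2 / 2 := by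
  have h1 := Real.quadratic_le_exp_of_nonneg hx
  have h2 : Real.exp (-x) * Real.exp x = 1 := by rw [← Real.exp_add]; simp
  have h3 : 0 ≤ 1 - x + x ^ 2 / 2 := by nlinarith [sq_nonneg (x - 1)]
  have h4 : 1 ≤ (1 - x + x ^ 2 / 2) * Real.exp x := by
    nlinarith [mul_le_mul_of_nonneg_left h1 h3, sq_nonneg (x ^ 2)]
  have h5 := Real.exp_pos x
  by_contra hcon
  push Not at hcon
  nlinarith [mul_lt_mul_of_pos_right hcon h5]

/-- the optimised weighted integral bound -/
lemma int_bound {h h' : ℝ → ℝ} {a γ c v0 τ : ℝ} (ha : 0 ≤ a) (hγ : 0 < γ) (hc : 0 ≤ c)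
    (hv0 : v0 = (1 + a) / (2 * γ)) (hτ1 : v0 ≤ τ) (hτ2 : a / γ ≤ τ)
    (hh : ∀ v ∈ Set.Icc 0 τ, HasDerivAt h (h' v) v)
    (hb1 : ∀ v ∈ Set.Icc 0 τ, h' v ≤ c * |v - v0|)
    (hb2 : ∀ v ∈ Set.Icc 0 τ, h' v ≤ c * (Real.exp (a - γ * v) * |v - v0|)) :
    h τ - h 0 ≤ c * ((3 / 4 + a / 2 + a ^ 2 / 4) / γ ^ 2) := by
  have hag : 0 ≤ a / γ := by positivity
  have hv0' : 0 ≤ v0 := by rw [hv0]; positivity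
  -- antiderivatives
  have dB1 : ∀ x, HasDerivAt (fun v => c * ((v - v0) ^ 2 / 2)) (c * (x - v0)) x := by
    intro x
    have := ((((hasDerivAt_id x).sub_const v0).pow 2).div_const 2).const_mul c
    refine this.congr_deriv ?_
    simp
  have dB2 : ∀ x, HasDerivAt (fun v => c * (-(Real.exp (a - γ * v) * ((v - v0) / γ + 1 / γ ^ 2))))
      (c * (Real.exp (a - γ * x) * (x - v0))) x := by
    intro x
    have e1 : HasDerivAt (fun v => Real.exp (a - γ * v)) (Real.exp (a - γ * x) * (-(γ * 1))) x :=
      (((hasDerivAt_id x).const_mul γ).const_sub a).exp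
    have e2 : HasDerivAt (fun v : ℝ => (v - v0) / γ + 1 / γ ^ 2) (1 / γ) x :=
      (((hasDerivAt_id x).sub_const v0).div_const γ).add_const _
    refine ((e1.mul e2).neg.const_mul c).congr_deriv ?_
    field_simp
    ring
  have seg1p : ∀ p q, 0 ≤ p → p ≤ q → q ≤ τ → v0 ≤ p →
      h q - h p ≤ c * ((q - v0) ^ 2 / 2) - c * ((p - v0) ^ 2 / 2) := by
    intro p q hp hpq hq hpv
    refine deriv_compare (B := fun v => c * ((v - v0) ^ 2 / 2)) hpq
      (fun x hx => hh x ⟨hp.trans hx.1, hx.2.trans hq⟩) (fun x _ => dB1 x) ?_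
    intro x hx
    have := hb1 x ⟨hp.trans hx.1, hx.2.trans hq⟩
    rwa [abs_of_nonneg (by linarith [hx.1])] at this
  have seg1n : ∀ p q, 0 ≤ p → p ≤ q → q ≤ τ → q ≤ v0 →
      h q - h p ≤ -(c * ((q - v0) ^ 2 / 2)) - -(c * ((p - v0) ^ 2 / 2)) := by
    intro p q hp hpq hq hpv
    refine deriv_compare (B := fun v => -(c * ((v - v0) ^ 2 / 2))) hpq
      (fun x hx => hh x ⟨hp.trans hx.1, hx.2.trans hq⟩) (fun x _ => (dB1 x).neg) ?_
    intro x hx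
    have := hb1 x ⟨hp.trans hx.1, hx.2.trans hq⟩
    rw [abs_of_nonpos (by linarith [hx.2])] at this
    linarith
  have seg2p : ∀ p q, 0 ≤ p → p ≤ q → q ≤ τ → v0 ≤ p →
      h q - h p ≤ c * (-(Real.exp (a - γ * q) * ((q - v0) / γ + 1 / γ ^ 2))) -
        c * (-(Real.exp (a - γ * p) * ((p - v0) / γ + 1 / γ ^ 2))) := by
    intro p q hp hpq hq hpv
    refine deriv_compare
      (B := fun v => c * (-(Real.exp (a - γ * v) * ((v - v0) / γ + 1 / γ ^ 2)))) hpq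
      (fun x hx => hh x ⟨hp.trans hx.1, hx.2.trans hq⟩) (fun x _ => dB2 x) ?_
    intro x hx
    have := hb2 x ⟨hp.trans hx.1, hx.2.trans hq⟩
    rwa [abs_of_nonneg (by linarith [hx.1])] at this
  have seg2n : ∀ p q, 0 ≤ p → p ≤ q → q ≤ τ → q ≤ v0 →
      h q - h p ≤ -(c * (-(Real.exp (a - γ * q) * ((q - v0) / γ + 1 / γ ^ 2)))) -
        -(c * (-(Real.exp (a - γ * p) * ((p - v0) / γ + 1 / γ ^ 2)))) := by
    intro p q hp hpq hq hpv
    refine deriv_compare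
      (B := fun v => -(c * (-(Real.exp (a - γ * v) * ((v - v0) / γ + 1 / γ ^ 2))))) hpq
      (fun x hx => hh x ⟨hp.trans hx.1, hx.2.trans hq⟩) (fun x _ => (dB2 x).neg) ?_
    intro x hx
    have := hb2 x ⟨hp.trans hx.1, hx.2.trans hq⟩
    rw [abs_of_nonpos (by linarith [hx.2])] at this
    linarith
  have hea : Real.exp (a - γ * (a / γ)) = 1 := by
    rw [mul_div_cancel₀ _ hγ.ne']; simp
  have hlast : 0 ≤ c * (Real.exp (a - γ * τ) * ((τ - v0) / γ + 1 / γ ^ 2)) := by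
    have : 0 ≤ τ - v0 := by linarith
    positivity
  rcases le_total v0 (a / γ) with hcase | hcase
  · have s1 := seg1n 0 v0 le_rfl hv0' hτ1 le_rfl
    have s2 := seg1p v0 (a / γ) hv0' hcase hτ2 le_rfl
    have s3 := seg2p (a / γ) τ hag hτ2 le_rfl hcase
    rw [hea] at s3
    have hid : ((0 - v0) ^ 2 / 2) + ((a / γ - v0) ^ 2 / 2) + ((a / γ - v0) / γ + 1 / γ ^ 2) =
        (3 / 4 + a / 2 + a ^ 2 / 4) / γ ^ 2 := by
      rw [hv0]; field_simp; ring
    rw [← hid]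
    have hz : c * ((v0 - v0) ^ 2 / 2) = 0 := by simp
    rw [hz] at s1 s2
    linarith
  · have s1 := seg1n 0 (a / γ) le_rfl hag hτ2 hcase
    have s2 := seg2n (a / γ) v0 hag hcase hτ1 le_rfl
    have s3 := seg2p v0 τ hv0' hτ1 le_rfl le_rfl
    rw [hea] at s2
    rw [sub_self, zero_div, zero_add] at s2 s3
    have hx : 0 ≤ γ * v0 - a := by
      have := mul_le_mul_of_nonneg_left hcase hγ.le
      rw [mul_div_cancel₀ _ hγ.ne'] at this; linarith
    have hq := exp_neg_le_quad hx
    rw [neg_sub] at hq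
    have hg2 : 0 ≤ 1 / γ ^ 2 := by positivity
    have hq2 : Real.exp (a - γ * v0) * (1 / γ ^ 2) ≤
        (1 - (γ * v0 - a) + (γ * v0 - a) ^ 2 / 2) * (1 / γ ^ 2) :=
      mul_le_mul_of_nonneg_right hq hg2
    have hq3 := mul_le_mul_of_nonneg_left hq2 hc
    have hid : ((0 - v0) ^ 2 / 2) - ((a / γ - v0) ^ 2 / 2) - ((a / γ - v0) / γ + 1 / γ ^ 2)
        + 2 * ((1 - (γ * v0 - a) + (γ * v0 - a) ^ 2 / 2) * (1 / γ ^ 2)) =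
        (3 / 4 + a / 2 + a ^ 2 / 4) / γ ^ 2 := by
      rw [hv0]; field_simp; ring
    rw [← hid]
    linarith

lemma diff_bound {d m : ℕ}
    (H : ℝ → Matrix (Fin d) (Fin d) ℂ)
    (J : ℝ → Fin m → Matrix (Fin d) (Fin d) ℂ)
    (hH : ∀ t, (H t).IsHermitian)
    (Lder : ℝ → Matrix (Fin d) (Fin d) ℂ → Matrix (Fin d) (Fin d) ℂ)
    (hder : ∀ t (x : Matrix (Fin d) (Fin d) ℂ) i k,
      HasDerivAt (fun u => (hamTerm (H u) x + totalDissipator (J u) x) i k)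
        ((Lder t x) i k) t)
    (δ : ℝ)
    (hbound : ∀ t, 0 ≤ t → ∀ x : Matrix (Fin d) (Fin d) ℂ,
      traceNorm (Lder t x) ≤ δ * traceNorm x) {t t0 : ℝ} (ht : 0 ≤ t) (ht0 : 0 ≤ t0)
    {x : Matrix (Fin d) (Fin d) ℂ} (hx : x.IsHermitian) :
    traceNorm (lindL (H t) (J t) x - lindL (H t0) (J t0) x) ≤ δ * |t - t0| * traceNorm x := by
  have hherm : ∀ t, (lindL (H t) (J t) x).IsHermitian := by
    intro t
    unfold Matrix.IsHermitian
    rw [lindL_apply, lind_star _ _ (hH t), hx.eq]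
  have hd : ∀ t, HasDerivAt (fun u => lindL (H u) (J u) x) (Lder t x) t := fun t =>
    hasDerivAt_mat.2 (hder t x)
  have hLh : ∀ t, (Lder t x).IsHermitian := by
    intro t
    ext i j
    rw [conjTranspose_apply]
    have h1 := hasDerivAt_mat.1 (hd t) i j
    have h2 := (hasDerivAt_mat.1 (hd t) j i).star
    refine h2.unique (h1.congr_of_eventuallyEq (Filter.Eventually.of_forall fun u => ?_))
    exact (hherm u).apply i j
  have main : ∀ p q, 0 ≤ p → p ≤ q →
      traceNorm (lindL (H q) (J q) x - lindL (H p) (J p) x) ≤ δ * (q - p) * traceNorm x := by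
    intro p q hp hpq
    obtain ⟨S, hS, h⟩ := tn_exists _ ((hherm q).sub (hherm p))
    rw [← h, Matrix.mul_sub, Matrix.trace_sub, Complex.sub_re]
    have := deriv_compare (h := fun u => ((S * lindL (H u) (J u) x).trace).re)
      (B := fun u => (δ * traceNorm x) * u) (B' := fun _ => (δ * traceNorm x) * 1) hpq
      (fun u _ => hasDerivAt_tr (hd u) S) (fun u _ => (hasDerivAt_id u).const_mul _)
      (fun u hu => by
        rw [mul_one]
        exact (tn_ge (hLh u) hS).trans (hbound u (hp.trans hu.1) x))
    refine this.trans (le_of_eq ?_)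
    ring
  rcases le_total t0 t with h | h
  · rw [abs_of_nonneg (by linarith)]; exact main t0 t ht0 h
  · rw [abs_of_nonpos (by linarith), ← tn_neg ((hherm t).sub (hherm t0)), neg_sub, neg_sub]
    exact main t t0 ht h

lemma window {d m : ℕ}
    (H : ℝ → Matrix (Fin d) (Fin d) ℂ)
    (J : ℝ → Fin m → Matrix (Fin d) (Fin d) ℂ)
    (hH : ∀ t, (H t).IsHermitian)
    (Lder : ℝ → Matrix (Fin d) (Fin d) ℂ → Matrix (Fin d) (Fin d) ℂ)
    (hder : ∀ t (x : Matrix (Fin d) (Fin d) ℂ) i k,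
      HasDerivAt (fun u => (hamTerm (H u) x + totalDissipator (J u) x) i k)
        ((Lder t x) i k) t)
    (K0 γ0 : ℝ) (hK0 : 1 ≤ K0) (hγ0 : 0 < γ0)
    (hinst : ∀ t0, 0 ≤ t0 → ExpContractiveWith
      (fun _ x => hamTerm (H t0) x + totalDissipator (J t0) x) K0 γ0)
    (δ : ℝ) (hδ0 : 0 ≤ δ)
    (hbound : ∀ t, 0 ≤ t → ∀ x : Matrix (Fin d) (Fin d) ℂ,
      traceNorm (Lder t x) ≤ δ * traceNorm x)
    {τ s : ℝ} (hs : 0 ≤ s) (hτ1 : (1 + Real.log K0) / (2 * γ0) ≤ τ) (hτ2 : Real.log K0 / γ0 ≤ τ)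
    (y : ℝ → Matrix (Fin d) (Fin d) ℂ)
    (hsol : ∀ t, s ≤ t → HasDerivAt y (lindL (H t) (J t) (y t)) t)
    (hy : ∀ t, s ≤ t → (y t).IsHermitian) (hy0 : ∀ t, s ≤ t → (y t).trace = 0) :
    traceNorm (y (s + τ)) ≤ (K0 * Real.exp (-γ0 * τ) +
      δ * ((3 / 4 + Real.log K0 / 2 + Real.log K0 ^ 2 / 4) / γ0 ^ 2)) * traceNorm (y s) := by
  set a := Real.log K0 with ha
  have ha0 : 0 ≤ a := Real.log_nonneg hK0
  set v0 := (1 + a) / (2 * γ0) with hv0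
  have hv0' : 0 ≤ v0 := by positivity
  set t0 := s + τ - v0 with ht0
  have ht0s : s ≤ t0 := by linarith
  have ht00 : 0 ≤ t0 := by linarith
  have hτ0 : 0 ≤ τ := by linarith
  set E := Ex (H t0) (J t0) with hE
  obtain ⟨U, hU, hUy⟩ := tn_exists _ (hy (s + τ) (by linarith))
  set z : ℝ → Matrix (Fin d) (Fin d) ℂ :=
    fun u => lindL (H u) (J u) (y u) - lindL (H t0) (J t0) (y u) with hz
  have hherm : ∀ t x, x.IsHermitian → (lindL (H t) (J t) x).IsHermitian := by
    intro t x hx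
    unfold Matrix.IsHermitian
    rw [lindL_apply, lind_star _ _ (hH t), hx.eq]
  have hzh : ∀ u, s ≤ u → (z u).IsHermitian := fun u hu =>
    (hherm u _ (hy u hu)).sub (hherm t0 _ (hy u hu))
  have hzt : ∀ u, (z u).trace = 0 := fun u => by
    simp only [hz, Matrix.trace_sub, lindL_apply, lind_trace, sub_zero]
  have hzn : ∀ u, s ≤ u → traceNorm (z u) ≤ δ * traceNorm (y s) * |u - t0| := by
    intro u hu
    have h1 := diff_bound H J hH Lder hder δ hbound (hs.trans hu) ht00 (hy u hu)
    have h2 := herm_contr H J y hu hsol hy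
    have h3 : δ * |u - t0| * traceNorm (y u) ≤ δ * |u - t0| * traceNorm (y s) :=
      mul_le_mul_of_nonneg_left h2 (by positivity)
    refine h1.trans (h3.trans (le_of_eq ?_))
    ring
  -- the interpolating function
  have hg : ∀ v ∈ Set.Icc 0 τ, HasDerivAt (fun v => E v (y (s + τ - v))) (-(E v (z (s + τ - v)))) v := by
    intro v hv
    have e1 := Ex_deriv' (H t0) (J t0) v
    have e2 := (hsol (s + τ - v) (by linarith [hv.2])).comp_const_sub (s + τ) v
    refine (e1.clm_apply e2).congr_deriv ?_
    have hL : (Ex (H t0) (J t0) v * Lc (H t0) (J t0)) (y (s + τ - v)) =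
      E v (lindL (H t0) (J t0) (y (s + τ - v))) := rfl
    rw [hL, map_neg]
    simp only [hz, map_sub]
    rw [← hE]
    abel
  have hk := int_bound (h := fun v => -((U * E v (y (s + τ - v))).trace).re)
    (h' := fun v => -((U * -(E v (z (s + τ - v)))).trace).re)
    (a := a) (γ := γ0) (c := δ * traceNorm (y s)) (v0 := v0) (τ := τ) ha0 hγ0
    (mul_nonneg hδ0 (tn_nonneg _)) hv0 hτ1 hτ2
    (fun v hv => (hasDerivAt_tr (hg v hv) U).neg) ?_ ?_
  · have hE0 : E 0 (y (s + τ - 0)) = y (s + τ) := by rw [hE, Ex_zero, sub_zero]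
    simp only [hE0, hUy, add_sub_cancel_right] at hk
    have h1 := tn_ge (Ex_herm (H t0) (J t0) (hH t0) (hy s le_rfl) hτ0) hU
    have h2 := Ex_decay (H t0) (J t0) (hH t0) (hinst t0 ht00) (hy s le_rfl) (hy0 s le_rfl) hτ0
    rw [← hE] at h1 h2
    linarith
  · intro v hv
    have hsv : s ≤ s + τ - v := by linarith [hv.2]
    rw [Matrix.mul_neg, Matrix.trace_neg, Complex.neg_re, neg_neg]
    have h1 := tn_ge (Ex_herm (H t0) (J t0) (hH t0) (hzh _ hsv) hv.1) hU
    have h2 := Ex_contr (H t0) (J t0) (hH t0) (hzh _ hsv) hv.1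
    have h3 := hzn _ hsv
    rw [show s + τ - v - t0 = -(v - v0) by rw [ht0]; ring, abs_neg] at h3
    exact h1.trans (h2.trans h3)
  · intro v hv
    have hsv : s ≤ s + τ - v := by linarith [hv.2]
    rw [Matrix.mul_neg, Matrix.trace_neg, Complex.neg_re, neg_neg]
    have h1 := tn_ge (Ex_herm (H t0) (J t0) (hH t0) (hzh _ hsv) hv.1) hU
    have h2 := Ex_decay (H t0) (J t0) (hH t0) (hinst t0 ht00) (hzh _ hsv) (hzt _) hv.1
    have h3 := hzn _ hsv
    rw [show s + τ - v - t0 = -(v - v0) by rw [ht0]; ring, abs_neg] at h3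
    have h4 : K0 * Real.exp (-γ0 * v) = Real.exp (a - γ0 * v) := by
      rw [ha, sub_eq_add_neg, Real.exp_add, Real.exp_log (by linarith), neg_mul]
    rw [h4] at h2
    refine h1.trans (h2.trans ?_)
    have := mul_le_mul_of_nonneg_left h3 (Real.exp_pos (a - γ0 * v)).le
    linarith

/-- iterating a contraction window -/
lemma iterate_window {f : ℝ → ℝ} {s τ q : ℝ} (hτ : 0 < τ) (hq : 0 < q) (hq1 : q < 1)
    (hf0 : ∀ t, 0 ≤ f t)
    (hmono : ∀ u t, s ≤ u → u ≤ t → f t ≤ f u) (hwin : ∀ u, s ≤ u → f (u + τ) ≤ q * f u)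
    {t : ℝ} (hst : s ≤ t) :
    f t ≤ q⁻¹ * Real.exp (-(-Real.log q / τ) * (t - s)) * f s := by
  have hit : ∀ n : ℕ, f (s + n * τ) ≤ q ^ n * f s := by
    intro n
    induction n with
    | zero => simp
    | succ k ih =>
      have h1 := hwin (s + k * τ) (by nlinarith [Nat.cast_nonneg (α := ℝ) k])
      have h2 := mul_le_mul_of_nonneg_left ih hq.le
      rw [show s + ((k + 1 : ℕ) : ℝ) * τ = s + k * τ + τ by push_cast; ring, pow_succ]
      linarith
  set n := ⌊(t - s) / τ⌋₊ with hn
  have hx0 : 0 ≤ (t - s) / τ := div_nonneg (by linarith) hτ.le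
  have hn1 : (n : ℝ) ≤ (t - s) / τ := Nat.floor_le hx0
  have hn2 : (t - s) / τ < n + 1 := Nat.lt_floor_add_one _
  have hn3 : (n : ℝ) * τ ≤ t - s := by rwa [le_div_iff₀ hτ] at hn1
  have h1 : f t ≤ f (s + n * τ) := hmono _ _ (by nlinarith [Nat.cast_nonneg (α := ℝ) n]) (by linarith)
  refine h1.trans ((hit n).trans (mul_le_mul_of_nonneg_right ?_ (hf0 s)))
  have e1 : q ^ n = Real.exp (n * Real.log q) := by
    rw [Real.exp_nat_mul, Real.exp_log hq]
  have e2 : q⁻¹ = Real.exp (- Real.log q) := by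
    rw [Real.exp_neg, Real.exp_log hq]
  rw [e1, e2, ← Real.exp_add]
  apply Real.exp_le_exp.2
  have hl : Real.log q < 0 := Real.log_neg hq hq1
  have : -(-Real.log q / τ) * (t - s) = Real.log q * ((t - s) / τ) := by ring
  rw [this]
  nlinarith

lemma main_aux {d m : ℕ}
    (H : ℝ → Matrix (Fin d) (Fin d) ℂ)
    (J : ℝ → Fin m → Matrix (Fin d) (Fin d) ℂ)
    (hH : ∀ t, (H t).IsHermitian)
    (Lder : ℝ → Matrix (Fin d) (Fin d) ℂ → Matrix (Fin d) (Fin d) ℂ)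
    (hder : ∀ t (x : Matrix (Fin d) (Fin d) ℂ) i k,
      HasDerivAt (fun u => (hamTerm (H u) x + totalDissipator (J u) x) i k)
        ((Lder t x) i k) t)
    (K0 γ0 : ℝ) (hγ0 : 0 < γ0)
    (hinst : ∀ t0, 0 ≤ t0 → ExpContractiveWith
      (fun _ x => hamTerm (H t0) x + totalDissipator (J t0) x) K0 γ0)
    (δ : ℝ) (hδ0 : 0 ≤ δ)
    (hbound : ∀ t, 0 ≤ t → ∀ x : Matrix (Fin d) (Fin d) ℂ,
      traceNorm (Lder t x) ≤ δ * traceNorm x)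
    (hlt : δ < 4 / 3 * γ0 ^ 2 /
      (1 + 2 / 3 * Real.log K0 + 1 / 3 * Real.log K0 ^ 2)) :
    ExpContractive (fun t x => hamTerm (H t) x + totalDissipator (J t) x) := by
  -- properties of differences of solutions
  have hdiff : ∀ (s : ℝ) (ρ σ : ℝ → Matrix (Fin d) (Fin d) ℂ),
      IsSolution (fun t x => hamTerm (H t) x + totalDissipator (J t) x) s ρ →
      IsSolution (fun t x => hamTerm (H t) x + totalDissipator (J t) x) s σ →
      IsDensity (ρ s) → IsDensity (σ s) →
      (∀ t, s ≤ t → HasDerivAt (fun t => ρ t - σ t) (lindL (H t) (J t) (ρ t - σ t)) t) ∧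
      (∀ t, s ≤ t → (ρ t - σ t).IsHermitian) ∧ (∀ t, s ≤ t → (ρ t - σ t).trace = 0) := by
    intro s ρ σ hρ hσ dρ dσ
    have h1 : ∀ t, s ≤ t → HasDerivAt (fun t => ρ t - σ t) (lindL (H t) (J t) (ρ t - σ t)) t := by
      intro t ht
      rw [map_sub]
      exact (hasDerivAt_mat.2 (hρ t ht)).sub (hasDerivAt_mat.2 (hσ t ht))
    refine ⟨h1, ?_, ?_⟩
    · exact herm_pres H J hH (fun t => ρ t - σ t) h1 (dρ.1.isHermitian.sub dσ.1.isHermitian)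
    · exact trace_pres H J (fun t => ρ t - σ t) h1 (by
        simp [Matrix.trace_sub, dρ.2, dσ.2])
  rcases lt_or_ge K0 1 with hK | hK
  · refine ⟨1, 1, one_pos, one_pos, ?_⟩
    intro s t hs hst ρ σ hρ hσ dρ dσ
    obtain ⟨h1, h2, h3⟩ := hdiff s ρ σ hρ hσ dρ dσ
    have hc := herm_contr H J (fun t => ρ t - σ t) hst h1 h2
    have hd := Ex_decay (H 0) (J 0) (hH 0) (hinst 0 le_rfl) (h2 s le_rfl) (h3 s le_rfl) le_rfl
    rw [Ex_zero, mul_zero, Real.exp_zero, mul_one] at hd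
    have h0 := tn_nonneg (ρ s - σ s)
    have hz : traceNorm (ρ s - σ s) = 0 := by nlinarith
    simp only [hz] at hc ⊢
    linarith
  · set a := Real.log K0 with ha
    have ha0 : 0 ≤ a := Real.log_nonneg hK
    set w := δ * ((3 / 4 + a / 2 + a ^ 2 / 4) / γ0 ^ 2) with hw
    have hw0 : 0 ≤ w := by positivity
    have hw1 : w < 1 := by
      have hden : 0 < 1 + 2 / 3 * a + 1 / 3 * a ^ 2 := by positivity
      rw [lt_div_iff₀ hden] at hlt
      rw [hw, ← mul_div_assoc, div_lt_one (by positivity)]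
      linarith
    obtain ⟨τ, hτK, hτ1, hτ2⟩ : ∃ τ, K0 * Real.exp (-γ0 * τ) < 1 - w ∧
        (1 + a) / (2 * γ0) ≤ τ ∧ a / γ0 ≤ τ := by
      have hlim : Filter.Tendsto (fun τ => K0 * Real.exp (-γ0 * τ)) Filter.atTop (nhds (K0 * 0)) := by
        refine Filter.Tendsto.const_mul _ (Real.tendsto_exp_atBot.comp ?_)
        exact Filter.tendsto_id.const_mul_atTop_of_neg (by linarith)
      rw [mul_zero] at hlim
      have h1 := hlim.eventually_lt_const (show (0:ℝ) < 1 - w by linarith)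
      exact (h1.and ((Filter.eventually_ge_atTop _).and (Filter.eventually_ge_atTop _))).exists
    have hτ0 : 0 < τ := lt_of_lt_of_le (by positivity) hτ1
    set q := K0 * Real.exp (-γ0 * τ) + w with hq
    have hq0 : 0 < q := by positivity
    have hq1 : q < 1 := by linarith
    refine ⟨q⁻¹, -Real.log q / τ, inv_pos.2 hq0,
      div_pos (neg_pos.2 (Real.log_neg hq0 hq1)) hτ0, ?_⟩
    intro s t hs hst ρ σ hρ hσ dρ dσ
    obtain ⟨h1, h2, h3⟩ := hdiff s ρ σ hρ hσ dρ dσ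
    refine iterate_window (f := fun t => traceNorm (ρ t - σ t)) hτ0 hq0 hq1
      (fun t => tn_nonneg _) ?_ ?_ hst
    · intro u t hsu hut
      exact herm_contr H J (fun t => ρ t - σ t) hut (fun t ht => h1 t (hsu.trans ht))
        (fun t ht => h2 t (hsu.trans ht))
    · intro u hsu
      exact window H J hH Lder hder K0 γ0 hK hγ0 hinst δ hδ0 hbound (hs.trans hsu) hτ1 hτ2
        (fun t => ρ t - σ t) (fun t ht => h1 t (hsu.trans ht)) (fun t ht => h2 t (hsu.trans ht))
        (fun t ht => h3 t (hsu.trans ht))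

end helpers




/-- a time-dependent Lindbladian whose instantaneous Lindbladians are
uniformly exponentially contractive and whose time derivative is small in superoperator
norm is exponentially contractive. -/
theorem slowly_varying_lindbladian_contractive {d m : ℕ}
    (H : ℝ → Matrix (Fin d) (Fin d) ℂ)
    (J : ℝ → Fin m → Matrix (Fin d) (Fin d) ℂ)
    (hH : ∀ t, (H t).IsHermitian)
    -- `Lder t` is the derivative `d L_t / dt` of the family of superoperators:
    (Lder : ℝ → Matrix (Fin d) (Fin d) ℂ → Matrix (Fin d) (Fin d) ℂ)
    (hder : ∀ t (x : Matrix (Fin d) (Fin d) ℂ) i k,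
      HasDerivAt (fun u => (hamTerm (H u) x + totalDissipator (J u) x) i k)
        ((Lder t x) i k) t)
    (K0 γ0 : ℝ) (hK0 : 0 < K0) (hγ0 : 0 < γ0)
    (hinst : ∀ t0, 0 ≤ t0 → ExpContractiveWith
      (fun _ x => hamTerm (H t0) x + totalDissipator (J t0) x) K0 γ0)
    -- `sup_{t ≥ 0} |||d L_t/dt||| < (4/3)γ0²/(1 + (2/3)ln K0 + (1/3)(ln K0)²)`,
    -- expressed via an upper bound `δ`:
    (δ : ℝ) (hδ0 : 0 ≤ δ)
    (hbound : ∀ t, 0 ≤ t → ∀ x : Matrix (Fin d) (Fin d) ℂ,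
      traceNorm (Lder t x) ≤ δ * traceNorm x)
    (hlt : δ < 4 / 3 * γ0 ^ 2 /
      (1 + 2 / 3 * Real.log K0 + 1 / 3 * Real.log K0 ^ 2)) :
    ExpContractive (fun t x => hamTerm (H t) x + totalDissipator (J t) x) := by
  exact main_aux H J hH Lder hder K0 γ0 hγ0 hinst δ hδ0 hbound hlt

end Paper
end

section
/- Let L_t(x) = −i[H(t), x] + D(x) be a driven Lindbladian on M_d(ℂ) with total dissipator D = Σ_j D_{L_j}, and let ρ, σ be solutions of the master equation whose values at time s are density matrices; set x(t) := ρ(t) − σ(t). Then the function t ↦ ‖x(t)‖₁ is right-differentiable for all t ≥ s, and its right derivative is given as follows: let y(t) := P·D(x(t))·P where P is the orthogonal projection onto the kernel of x(t); choose an orthonormal basis {e_k} of ℂ^d that diagonalizes x(t) and y(t) simultaneously, writing x(t) = Σ_k λ_k |e_k⟩⟨e_k|; let s_k ∈ {−1, 0, 1} be the eigenvalue of sgn(x(t) + y(t)) on e_k (where sgn applies the real sign function to the eigenvalues of a Hermitian matrix), and put f(k, l) := 1 − s_k·s_l. Then ∂_{t,+}‖x(t)‖₁ = −Σ_{k,l}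 |λ_k|·f(k, l)·Σ_j |⟨e_l, L_j e_k⟩|². -/
open scoped ComplexOrder Kronecker
open Matrix

namespace Paper

/-- Orthogonal projection onto the kernel of the matrix `Σ_k λ_k |e_k⟩⟨e_k|`. -/
noncomputable def kerProj {d : ℕ} (e : Fin d → Fin d → ℂ) (lam : Fin d → ℝ) :
    Matrix (Fin d) (Fin d) ℂ :=
  ∑ k, if lam k = 0 then Matrix.vecMulVec (e k) (star (e k)) else 0

/-- Contractions for the Euclidean norm. -/
def Contr {n : Type*} [Fintype n] [DecidableEq n] (W : Matrix n n ℂ) : Prop :=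
  ∀ z : EuclideanSpace ℂ n, ‖Matrix.toEuclideanLin W z‖ ≤ ‖z‖

lemma trace_eq_sum_basis {n : Type*} [Fintype n] [DecidableEq n] (M : Matrix n n ℂ)
    (b : OrthonormalBasis n ℂ (EuclideanSpace ℂ n)) :
    M.trace = ∑ i, inner ℂ (b i) (Matrix.toEuclideanLin M (b i)) := by
  rw [← LinearMap.trace_eq_sum_inner, Matrix.toEuclideanLin_eq_toLin, Matrix.trace_toLin_eq]

lemma inner_gram {n : Type*} [Fintype n] [DecidableEq n] (X : Matrix n n ℂ)
    (a b : EuclideanSpace ℂ n) :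
    inner ℂ (Matrix.toEuclideanLin X a) (Matrix.toEuclideanLin X b)
      = inner ℂ a (Matrix.toEuclideanLin (Xᴴ * X) b) := by
  rw [Matrix.toLpLin_mul_same, Matrix.toEuclideanLin_conjTranspose_eq_adjoint,
    LinearMap.comp_apply, LinearMap.adjoint_inner_right]

lemma inner_eig {n : Type*} [Fintype n] [DecidableEq n] (X : Matrix n n ℂ) (i j : n) :
    inner ℂ (Matrix.toEuclideanLin X
        ((Matrix.posSemidef_conjTranspose_mul_self X).isHermitian.eigenvectorBasis i))
      (Matrix.toEuclideanLin X
        ((Matrix.posSemidef_conjTranspose_mul_self X).isHermitian.eigenvectorBasis j))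
      = if i = j then
        ((Matrix.posSemidef_conjTranspose_mul_self X).isHermitian.eigenvalues i : ℂ) else 0 := by
  set hh := (Matrix.posSemidef_conjTranspose_mul_self X).isHermitian
  have h1 : Matrix.toEuclideanLin (Xᴴ * X) (hh.eigenvectorBasis j)
      = (hh.eigenvalues j : ℂ) • hh.eigenvectorBasis j := by
    rw [Matrix.toLpLin_apply, hh.mulVec_eigenvectorBasis]
    ext k; simp
  rw [inner_gram, h1, inner_smul_right, orthonormal_iff_ite.mp hh.eigenvectorBasis.orthonormal]
  split_ifs with h
  · subst h; simp
  · simp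

lemma norm_eig {n : Type*} [Fintype n] [DecidableEq n] (X : Matrix n n ℂ) (i : n) :
    ‖Matrix.toEuclideanLin X
        ((Matrix.posSemidef_conjTranspose_mul_self X).isHermitian.eigenvectorBasis i)‖
      = Real.sqrt ((Matrix.posSemidef_conjTranspose_mul_self X).isHermitian.eigenvalues i) := by
  have h := inner_eig X i i
  rw [inner_self_eq_norm_sq_to_K] at h
  simp only [if_true] at h
  have h' : ‖Matrix.toEuclideanLin X
        ((Matrix.posSemidef_conjTranspose_mul_self X).isHermitian.eigenvectorBasis i)‖ ^ 2
      = (Matrix.posSemidef_conjTranspose_mul_self X).isHermitian.eigenvalues i := by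
    exact Complex.ofReal_injective (by push_cast; exact h)
  rw [← h', Real.sqrt_sq (norm_nonneg _)]

lemma re_trace_le {n : Type*} [Fintype n] [DecidableEq n] (W X : Matrix n n ℂ) (hW : Contr W) :
    (W * X).trace.re ≤ traceNorm X := by
  set hh := (Matrix.posSemidef_conjTranspose_mul_self X).isHermitian with hhd
  rw [trace_eq_sum_basis _ hh.eigenvectorBasis, Complex.re_sum, traceNorm]
  refine Finset.sum_le_sum fun i _ => ?_
  rw [Matrix.toLpLin_mul_same, LinearMap.comp_apply, ← norm_eig]
  refine (Complex.re_le_norm _).trans ((norm_inner_le_norm _ _).trans ?_)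
  rw [hh.eigenvectorBasis.norm_eq_one, one_mul]
  exact hW _

lemma exists_contr {n : Type*} [Fintype n] [DecidableEq n] (X : Matrix n n ℂ) :
    ∃ W : Matrix n n ℂ, Contr W ∧ (W * X).trace.re = traceNorm X := by
  set hh := (Matrix.posSemidef_conjTranspose_mul_self X).isHermitian with hhd
  set v := hh.eigenvectorBasis
  set μ := hh.eigenvalues with hμ
  have hμ0 : ∀ i, 0 ≤ μ i := (Matrix.posSemidef_conjTranspose_mul_self X).eigenvalues_nonneg
  set q : n → EuclideanSpace ℂ n := fun i => Matrix.toEuclideanLin X (v i) with hq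
  have hqq : ∀ i j, inner ℂ (q i) (q j) = if i = j then (μ i : ℂ) else 0 := inner_eig X
  let T : EuclideanSpace ℂ n →ₗ[ℂ] EuclideanSpace ℂ n :=
    ∑ i, ((innerₛₗ ℂ (((Real.sqrt (μ i))⁻¹ : ℂ) • q i))).smulRight (v i)
  have hT : ∀ z, T z = ∑ i, (inner ℂ (((Real.sqrt (μ i))⁻¹ : ℂ) • q i) z : ℂ) • v i := by
    intro z; simp [T, mul_comm]
  refine ⟨Matrix.toEuclideanLin.symm T, ?_, ?_⟩
  · intro z
    rw [LinearEquiv.apply_symm_apply, hT]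
    rw [← abs_of_nonneg (norm_nonneg z), ← abs_of_nonneg (norm_nonneg (∑ i, _)), ← sq_le_sq]
    have h1 : ‖∑ i, (inner ℂ (((Real.sqrt (μ i))⁻¹ : ℂ) • q i) z : ℂ) • v i‖ ^ 2
        = ∑ i, ‖(inner ℂ (((Real.sqrt (μ i))⁻¹ : ℂ) • q i) z : ℂ)‖ ^ 2 := by
      rw [← v.sum_sq_norm_inner_right]
      refine Finset.sum_congr rfl fun i _ => ?_
      rw [v.orthonormal.inner_right_fintype]
    rw [h1]
    have h2 : Orthonormal ℂ (fun i : {i // μ i ≠ 0} => ((Real.sqrt (μ i))⁻¹ : ℂ) • q i) := by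
      rw [orthonormal_iff_ite]
      rintro ⟨i, hi⟩ ⟨j, hj⟩
      rw [inner_smul_left, inner_smul_right, hqq]
      by_cases hij : i = j
      · subst hij
        have : Real.sqrt (μ i) ≠ 0 := by
          rw [Real.sqrt_ne_zero (hμ0 i)]; exact hi
        simp only [if_true]
        have h3 : ((μ i : ℝ) : ℂ) = (Real.sqrt (μ i) : ℂ) * (Real.sqrt (μ i) : ℂ) := by
          rw [← Complex.ofReal_mul, Real.mul_self_sqrt (hμ0 i)]
        have h4 : (Real.sqrt (μ i) : ℂ) ≠ 0 := by exact_mod_cast this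
        rw [h3]
        simp [Complex.conj_ofReal]
        field_simp
      · simp [hij]
    calc _ = ∑ i : {i // μ i ≠ 0}, ‖(inner ℂ (((Real.sqrt (μ i))⁻¹ : ℂ) • q i) z : ℂ)‖ ^ 2 := by
          rw [← Finset.sum_subtype (Finset.univ.filter (fun i => μ i ≠ 0)) (by simp)
            (fun i => ‖(inner ℂ (((Real.sqrt (μ i))⁻¹ : ℂ) • q i) z : ℂ)‖ ^ 2)]
          rw [Finset.sum_filter]
          refine Finset.sum_congr rfl fun i _ => ?_
          by_cases h : μ i = 0
          · simp [h]
          · simp [h]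
      _ ≤ _ := h2.sum_inner_products_le (x := z)
  · rw [trace_eq_sum_basis _ v, Complex.re_sum, traceNorm]
    refine Finset.sum_congr rfl fun i _ => ?_
    rw [Matrix.toLpLin_mul_same, LinearMap.comp_apply, LinearEquiv.apply_symm_apply, hT,
      v.orthonormal.inner_right_fintype]
    change (inner ℂ _ (q i)).re = √(μ i)
    rw [inner_smul_left, hqq]
    simp only [if_true]
    rw [← Complex.ofReal_inv, Complex.conj_ofReal, ← Complex.ofReal_mul, Complex.ofReal_re]
    nth_rewrite 2 [← Real.mul_self_sqrt (hμ0 i)]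
    by_cases h : Real.sqrt (μ i) = 0
    · simp [h]
    · field_simp

lemma traceNorm_add_le_s12 {n : Type*} [Fintype n] [DecidableEq n] (X Y : Matrix n n ℂ) :
    traceNorm (X + Y) ≤ traceNorm X + traceNorm Y := by
  obtain ⟨W, hW, h⟩ := exists_contr (X + Y)
  rw [← h, mul_add, Matrix.trace_add, Complex.add_re]
  exact add_le_add (re_trace_le W X hW) (re_trace_le W Y hW)

lemma traceNorm_zero_le {n : Type*} [Fintype n] [DecidableEq n] :
    traceNorm (0 : Matrix n n ℂ) ≤ 0 := by
  obtain ⟨W, hW, h⟩ := exists_contr (0 : Matrix n n ℂ)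
  rw [← h]; simp

lemma traceNorm_sum_le {n ι : Type*} [Fintype n] [DecidableEq n] (s : Finset ι)
    (X : ι → Matrix n n ℂ) :
    traceNorm (∑ i ∈ s, X i) ≤ ∑ i ∈ s, traceNorm (X i) := by
  classical
  induction s using Finset.induction_on with
  | empty => simpa using traceNorm_zero_le
  | insert a s ha ih =>
    rw [Finset.sum_insert ha, Finset.sum_insert ha]
    exact (traceNorm_add_le_s12 _ _).trans (by gcongr)

lemma contr_bilin {n : Type*} [Fintype n] [DecidableEq n] (W : Matrix n n ℂ) (hW : Contr W)
    (a b : EuclideanSpace ℂ n) : ‖star (a : n → ℂ) ⬝ᵥ (W *ᵥ (b : n → ℂ))‖ ≤ ‖a‖ * ‖b‖ := by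
  have h : star (a : n → ℂ) ⬝ᵥ (W *ᵥ (b : n → ℂ)) = inner ℂ a (Matrix.toEuclideanLin W b) := by
    rw [EuclideanSpace.inner_eq_star_dotProduct, dotProduct_comm]; rfl
  rw [h]
  exact (norm_inner_le_norm _ _).trans (by gcongr; exact hW b)

lemma traceNorm_rankOne_le {n : Type*} [Fintype n] [DecidableEq n] (c : ℝ) (w : n → ℂ) :
    traceNorm ((c : ℂ) • Matrix.vecMulVec w (star w)) ≤ |c| * ∑ i, ‖w i‖ ^ 2 := by
  obtain ⟨W, hW, h⟩ := exists_contr ((c : ℂ) • Matrix.vecMulVec w (star w))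
  have h2 := contr_bilin W hW (WithLp.toLp 2 w) (WithLp.toLp 2 w)
  rw [← h, Matrix.mul_smul, Matrix.trace_smul, Matrix.mul_vecMulVec, Matrix.trace_vecMulVec,
    dotProduct_comm]
  refine (Complex.re_le_norm _).trans ?_
  rw [smul_eq_mul, norm_mul, Complex.norm_real, Real.norm_eq_abs]
  gcongr
  refine h2.trans ?_
  rw [← sq, EuclideanSpace.norm_sq_eq]

lemma traceNorm_le_entries {n : Type*} [Fintype n] [DecidableEq n] (R : Matrix n n ℂ) :
    traceNorm R ≤ ∑ i, ∑ j, ‖R i j‖ := by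
  obtain ⟨W, hW, h⟩ := exists_contr R
  rw [← h, Matrix.trace_mul_comm]
  refine (Complex.re_le_norm _).trans ?_
  simp only [Matrix.trace, Matrix.diag, Matrix.mul_apply]
  refine (norm_sum_le _ _).trans (Finset.sum_le_sum fun i _ => ?_)
  refine (norm_sum_le _ _).trans (Finset.sum_le_sum fun j _ => ?_)
  rw [norm_mul]
  have h2 := contr_bilin W hW (EuclideanSpace.single j 1) (EuclideanSpace.single i 1)
  have h3 : ‖W j i‖ ≤ 1 := by
    simpa [← Pi.single_star] using h2
  exact mul_le_of_le_one_right (norm_nonneg _) h3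

lemma Contr.mul {n : Type*} [Fintype n] [DecidableEq n] {V W : Matrix n n ℂ} (hV : Contr V)
    (hW : Contr W) : Contr (V * W) := by
  intro z
  rw [Matrix.toLpLin_mul_same]
  exact (hV _).trans (hW _)

lemma contr_of_isometry {n : Type*} [Fintype n] [DecidableEq n] {U : Matrix n n ℂ}
    (h : Uᴴ * U = 1) : Contr U := by
  intro z
  have h1 := inner_gram U z z
  rw [h, Matrix.toLpLin_one, inner_self_eq_norm_sq_to_K] at h1
  simp only [LinearMap.id_apply] at h1
  rw [inner_self_eq_norm_sq_to_K] at h1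
  have h2 : ‖Matrix.toEuclideanLin U z‖ ^ 2 = ‖z‖ ^ 2 := by exact_mod_cast h1
  exact le_of_eq ((sq_eq_sq₀ (norm_nonneg _) (norm_nonneg _)).mp h2)

lemma traceNorm_conj_le {n : Type*} [Fintype n] [DecidableEq n] {U : Matrix n n ℂ}
    (h : Uᴴ * U = 1) (h' : U * Uᴴ = 1) (X : Matrix n n ℂ) :
    traceNorm (Uᴴ * X * U) ≤ traceNorm X := by
  obtain ⟨W, hW, hh⟩ := exists_contr (Uᴴ * X * U)
  have h1 : (W * (Uᴴ * X * U)).trace = ((U * W * Uᴴ) * X).trace := by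
    rw [Matrix.trace_mul_comm, Matrix.trace_mul_comm _ X]
    simp only [Matrix.mul_assoc]
    rw [Matrix.trace_mul_comm]
    simp only [Matrix.mul_assoc]
  rw [← hh, h1]
  apply re_trace_le
  exact ((contr_of_isometry h).mul hW).mul (contr_of_isometry (by simpa using h'))

lemma traceNorm_conj {n : Type*} [Fintype n] [DecidableEq n] {U : Matrix n n ℂ}
    (h : Uᴴ * U = 1) (h' : U * Uᴴ = 1) (X : Matrix n n ℂ) :
    traceNorm (Uᴴ * X * U) = traceNorm X := by
  apply le_antisymm (traceNorm_conj_le h h' X)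
  have h2 := traceNorm_conj_le (U := Uᴴ) (by simpa using h') (by simpa using h) (Uᴴ * X * U)
  have h3 : Uᴴᴴ * (Uᴴ * X * U) * Uᴴ = X := by
    rw [conjTranspose_conjTranspose]
    calc _ = (U * Uᴴ) * X * (U * Uᴴ) := by simp only [Matrix.mul_assoc]
      _ = X := by rw [h']; simp
  rwa [h3] at h2

lemma contr_diagonal {n : Type*} [Fintype n] [DecidableEq n] (g : n → ℝ) (hg : ∀ i, |g i| ≤ 1) :
    Contr (Matrix.diagonal fun i => (g i : ℂ)) := by
  intro z
  rw [← abs_of_nonneg (norm_nonneg z), ← abs_of_nonneg (norm_nonneg (toEuclideanLin _ z)),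
    ← sq_le_sq, EuclideanSpace.norm_sq_eq, EuclideanSpace.norm_sq_eq]
  refine Finset.sum_le_sum fun i _ => ?_
  gcongr
  rw [Matrix.toLpLin_apply]
  simp only [Matrix.mulVec_diagonal, norm_mul, Complex.norm_real, Real.norm_eq_abs]
  exact mul_le_of_le_one_left (norm_nonneg _) (hg i)

lemma hasDerivWithinAt_squeeze {lo f up : ℝ → ℝ} {t a : ℝ}
    (h1 : ∀ u, lo u ≤ f u) (h2 : ∀ u, f u ≤ up u) (h3 : lo t = up t)
    (hlo : HasDerivWithinAt lo a (Set.Ioi t) t) (hup : HasDerivWithinAt up a (Set.Ioi t) t) :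
    HasDerivWithinAt f a (Set.Ioi t) t := by
  have e1 : lo t = f t := le_antisymm (h1 t) ((h2 t).trans h3.ge)
  have e2 : up t = f t := h3.symm.trans e1
  rw [hasDerivWithinAt_iff_tendsto_slope' Set.self_notMem_Ioi] at *
  refine tendsto_of_tendsto_of_tendsto_of_le_of_le' hlo hup ?_ ?_
  · filter_upwards [self_mem_nhdsWithin] with u hu
    have : 0 < u - t := sub_pos.mpr hu
    rw [slope_def_field, slope_def_field, e1]
    have := h1 u
    gcongr
  · filter_upwards [self_mem_nhdsWithin] with u hu
    have : 0 < u - t := sub_pos.mpr hu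
    rw [slope_def_field, slope_def_field, e2]
    have := h2 u
    gcongr

lemma hasDerivAt_norm_zero {G : ℝ → ℂ} {t : ℝ} (h0 : G t = 0) (h : HasDerivAt G 0 t) :
    HasDerivAt (fun u => ‖G u‖) 0 t := by
  rw [hasDerivAt_iff_isLittleO] at *
  simp only [h0, norm_zero, sub_zero, smul_zero] at *
  exact h.norm_left

lemma hasDerivWithinAt_abs_aux (l b g t : ℝ) (h1 : l ≠ 0 → g = Real.sign l)
    (h2 : l = 0 → g = Real.sign b) :
    HasDerivWithinAt (fun u => |l + (u - t) * b|) (g * b) (Set.Ioi t) t := by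
  have hd : HasDerivAt (fun u : ℝ => l + (u - t) * b) b t := by
    simpa using (((hasDerivAt_id t).sub_const t).mul_const b).const_add l
  rcases lt_trichotomy l 0 with h | h | h
  · rw [h1 h.ne, Real.sign_of_neg h]
    refine HasDerivAt.hasDerivWithinAt ?_
    have := (hasDerivAt_abs_neg (x := l + (t - t) * b) (by simpa using h)).comp t hd
    exact this
  · rw [h2 h, h]
    have : HasDerivAt (fun u : ℝ => (u - t) * |b|) (|b|) t := by
      simpa using (((hasDerivAt_id t).sub_const t).mul_const |b|)
    have hb : Real.sign b * b = |b| := by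
      rcases lt_trichotomy b 0 with h | h | h
      · rw [Real.sign_of_neg h, abs_of_neg h]; ring
      · simp [h]
      · rw [Real.sign_of_pos h, abs_of_pos h]; ring
    rw [hb]
    refine this.hasDerivWithinAt.congr ?_ ?_
    · intro u hu
      have : 0 < u - t := sub_pos.mpr hu
      simp [abs_mul, abs_of_pos this]
    · simp
  · rw [h1 h.ne', Real.sign_of_pos h]
    refine HasDerivAt.hasDerivWithinAt ?_
    have := (hasDerivAt_abs_pos (x := l + (t - t) * b) (by simpa using h)).comp t hd
    exact this

lemma main_diag {d : ℕ} (X : ℝ → Matrix (Fin d) (Fin d) ℂ) (B : Matrix (Fin d) (Fin d) ℂ)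
    (t : ℝ) (lam sg : Fin d → ℝ)
    (hX : ∀ i j, HasDerivAt (fun u => X u i j) (B i j) t)
    (hXt : X t = Matrix.diagonal (fun k => (lam k : ℂ)))
    (hB : B.IsHermitian)
    (h0 : ∀ k l, k ≠ l → lam k = 0 → lam l = 0 → B k l = 0)
    (hs1 : ∀ k, |sg k| ≤ 1)
    (hs2 : ∀ k, lam k ≠ 0 → sg k = Real.sign (lam k))
    (hs3 : ∀ k, lam k = 0 → sg k = Real.sign (B k k).re) :
    HasDerivWithinAt (fun u => traceNorm (X u)) (∑ k, sg k * (B k k).re) (Set.Ioi t) t := by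
  have hsl : ∀ k, sg k * lam k = |lam k| := by
    intro k
    rcases lt_trichotomy (lam k) 0 with h | h | h
    · rw [hs2 k h.ne, Real.sign_of_neg h, abs_of_neg h]; ring
    · simp [h]
    · rw [hs2 k h.ne', Real.sign_of_pos h, abs_of_pos h]; ring
  -- the generator
  obtain ⟨K, hK1, hK2⟩ : ∃ K : Fin d → Fin d → ℂ, (∀ k, K k k = 0) ∧
      ∀ k l, k ≠ l → K k l * lam l + lam k * star (K l k) = B k l := by
    refine ⟨fun k l => if k = l then 0 else B k l * lam l / ((lam k : ℂ) ^ 2 + (lam l : ℂ) ^ 2),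
      fun k => by simp, ?_⟩
    intro k l hkl
    have hBs : star (B l k) = B k l := hB.apply k l
    simp only [hkl, hkl.symm, if_false]
    by_cases hz : lam k = 0 ∧ lam l = 0
    · simp [hz.1, hz.2, h0 k l hkl hz.1 hz.2]
    · have hne : ((lam k : ℂ) ^ 2 + (lam l : ℂ) ^ 2) ≠ 0 := by
        have : lam k ^ 2 + lam l ^ 2 ≠ 0 := by
          intro h
          apply hz
          constructor <;> nlinarith [sq_nonneg (lam k), sq_nonneg (lam l)]
        exact_mod_cast this
      have h3 : star (B l k * lam k / ((lam l : ℂ) ^ 2 + (lam k : ℂ) ^ 2))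
          = B k l * lam k / ((lam k : ℂ) ^ 2 + (lam l : ℂ) ^ 2) := by
        rw [← hBs, add_comm ((lam k : ℂ) ^ 2)]
        simp
      rw [h3]
      field_simp
      ring
  have hBre : ∀ k, ((B k k).re : ℂ) = B k k := by
    intro k
    have := hB.apply k k
    exact Complex.conj_eq_iff_re.mp this
  let c : Fin d → ℝ → ℝ := fun k u => lam k + (u - t) * (B k k).re
  let w : Fin d → ℝ → Fin d → ℂ := fun k u i => (if i = k then 1 else 0) + ((u - t : ℝ) : ℂ) * K i k
  let G : Fin d → Fin d → ℝ → ℂ := fun i j u =>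
    X u i j - ∑ k, (c k u : ℂ) * (w k u i * star (w k u j))
  have hG0 : ∀ i j, G i j t = 0 := by
    intro i j
    simp only [G, c, w, hXt, sub_self]
    by_cases h : i = j
    · subst h; simp
    · simp [h, Matrix.diagonal]
  have hreal : HasDerivAt (fun u : ℝ => ((u - t : ℝ) : ℂ)) 1 t := by
    have := ((hasDerivAt_id t).sub_const t).ofReal_comp
    simpa using this
  have hw : ∀ k i, HasDerivAt (fun u => w k u i) (K i k) t := by
    intro k i
    exact ((hreal.mul_const (K i k)).const_add (if i = k then (1 : ℂ) else 0)).congr_deriv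
      (one_mul _)
  have hc : ∀ k, HasDerivAt (fun u => (c k u : ℂ)) (B k k) t := by
    intro k
    have := ((hreal.mul_const (B k k)).const_add (lam k : ℂ)).congr_deriv (one_mul _)
    have he : (fun u => (c k u : ℂ)) = fun u => (lam k : ℂ) + ((u - t : ℝ) : ℂ) * B k k := by
      funext u
      simp only [c]
      rw [← hBre k]
      push_cast
      simp
    rw [he]
    exact this
  have hG : ∀ i j, HasDerivAt (G i j) 0 t := by
    intro i j
    have h1 := (hX i j).sub (HasDerivAt.fun_sum (u := Finset.univ)
      fun k _ => (hc k).mul ((hw k i).mul (hw k j).star))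
    refine h1.congr_deriv ?_
    simp only [w, c, sub_self]
    by_cases h : i = j
    · subst h
      simp [hK1, Finset.sum_add_distrib, mul_add]
    · have := hK2 i j h
      simp [h, Ne.symm h, Finset.sum_add_distrib, mul_add, ← this]
      ring
  have hwn : ∀ k u, ∑ i, ‖w k u i‖ ^ 2 = 1 + (u - t) ^ 2 * ∑ i, ‖K i k‖ ^ 2 := by
    intro k u
    have : ∀ i, ‖w k u i‖ ^ 2 = (if i = k then 1 else 0) + (u - t) ^ 2 * ‖K i k‖ ^ 2 := by
      intro i
      by_cases h : i = k
      · subst h; simp [w, hK1]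
      · simp only [w, h, if_false, zero_add, norm_mul, Complex.norm_real, mul_pow,
          Real.norm_eq_abs, sq_abs]
    simp [this, Finset.sum_add_distrib, Finset.mul_sum]
  refine hasDerivWithinAt_squeeze (lo := fun u => ∑ k, sg k * (X u k k).re)
    (up := fun u => (∑ k, |c k u| * (1 + (u - t) ^ 2 * ∑ i, ‖K i k‖ ^ 2))
      + ∑ i, ∑ j, ‖G i j u‖) ?_ ?_ ?_ ?_ ?_
  · intro u
    have := re_trace_le _ (X u) (contr_diagonal sg hs1)
    refine le_trans (le_of_eq ?_) this
    simp [Matrix.trace, Matrix.diagonal_mul]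
  · intro u
    have hdec : X u = (∑ k, (c k u : ℂ) • Matrix.vecMulVec (w k u) (star (w k u)))
        + Matrix.of (fun i j => G i j u) := by
      ext i j
      simp [G, Matrix.sum_apply, Matrix.vecMulVec_apply]
    have h1 := traceNorm_add_le_s12 (∑ k, (c k u : ℂ) • Matrix.vecMulVec (w k u) (star (w k u)))
      (Matrix.of (fun i j => G i j u))
    rw [← hdec] at h1
    refine h1.trans (add_le_add ?_ ?_)
    · refine (traceNorm_sum_le _ _).trans (Finset.sum_le_sum fun k _ => ?_)
      rw [← hwn]
      exact traceNorm_rankOne_le _ _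
    · simpa using traceNorm_le_entries (Matrix.of (fun i j => G i j u))
  · simp [hG0, hXt, c, hsl]
  · refine HasDerivAt.hasDerivWithinAt ?_
    refine HasDerivAt.fun_sum fun k _ => ?_
    refine HasDerivAt.const_mul _ ?_
    exact (Complex.reCLM.hasFDerivAt.comp_hasDerivAt t (hX k k))
  · have h1 : HasDerivWithinAt (fun u => ∑ k, |c k u| * (1 + (u - t) ^ 2 * ∑ i, ‖K i k‖ ^ 2))
        (∑ k, sg k * (B k k).re) (Set.Ioi t) t := by
      refine HasDerivWithinAt.fun_sum fun k _ => ?_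
      have ha := hasDerivWithinAt_abs_aux (lam k) (B k k).re (sg k) t (hs2 k) (hs3 k)
      have hb : HasDerivAt (fun u : ℝ => 1 + (u - t) ^ 2 * ∑ i, ‖K i k‖ ^ 2) 0 t := by
        simpa using (((((hasDerivAt_id t).sub_const t).pow 2).mul_const
          (∑ i, ‖K i k‖ ^ 2)).const_add 1)
      have := ha.mul hb.hasDerivWithinAt
      exact this.congr_deriv (by simp)
    have h2 : HasDerivAt (fun u => ∑ i, ∑ j, ‖G i j u‖) 0 t := by
      have := HasDerivAt.fun_sum (u := Finset.univ) fun i _ =>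
        HasDerivAt.fun_sum (u := Finset.univ) fun j _ => hasDerivAt_norm_zero (hG0 i j) (hG i j)
      simpa using this
    exact (h1.add h2.hasDerivWithinAt).congr_deriv (add_zero _)

lemma hamTerm_sub {d : ℕ} (H x z : Matrix (Fin d) (Fin d) ℂ) :
    hamTerm H (x - z) = hamTerm H x - hamTerm H z := by
  simp only [hamTerm, ← smul_sub]
  congr 1
  noncomm_ring

lemma dissipator_sub {d : ℕ} (L x z : Matrix (Fin d) (Fin d) ℂ) :
    dissipator L (x - z) = dissipator L x - dissipator L z := by
  simp only [dissipator]
  rw [sub_sub_sub_comm, ← smul_sub]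
  congr 1
  · noncomm_ring
  · congr 1
    noncomm_ring

lemma driven_sub {d m : ℕ} (H : ℝ → Matrix (Fin d) (Fin d) ℂ)
    (L : Fin m → Matrix (Fin d) (Fin d) ℂ) (t : ℝ) (x z : Matrix (Fin d) (Fin d) ℂ) :
    driven H L t (x - z) = driven H L t x - driven H L t z := by
  simp only [driven, totalDissipator, hamTerm_sub, dissipator_sub, Finset.sum_sub_distrib]
  abel

lemma conj_mul3 {d : ℕ} {U : Matrix (Fin d) (Fin d) ℂ} (h' : U * Uᴴ = 1)
    (A B : Matrix (Fin d) (Fin d) ℂ) :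
    Uᴴ * (A * B) * U = (Uᴴ * A * U) * (Uᴴ * B * U) := by
  calc _ = Uᴴ * A * 1 * B * U := by simp only [Matrix.mul_assoc, Matrix.mul_one, Matrix.one_mul]
    _ = _ := by rw [← h']; simp only [Matrix.mul_assoc]

lemma conj_star {d : ℕ} (U A : Matrix (Fin d) (Fin d) ℂ) :
    Uᴴ * Aᴴ * U = (Uᴴ * A * U)ᴴ := by
  simp [Matrix.conjTranspose_mul, Matrix.mul_assoc]

lemma hamTerm_conj {d : ℕ} {U : Matrix (Fin d) (Fin d) ℂ} (h' : U * Uᴴ = 1)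
    (H x : Matrix (Fin d) (Fin d) ℂ) :
    Uᴴ * hamTerm H x * U = hamTerm (Uᴴ * H * U) (Uᴴ * x * U) := by
  simp only [hamTerm, Matrix.mul_smul, Matrix.smul_mul, Matrix.mul_sub, Matrix.sub_mul]
  simp only [conj_mul3 h']

lemma dissipator_conj {d : ℕ} {U : Matrix (Fin d) (Fin d) ℂ} (h' : U * Uᴴ = 1)
    (L x : Matrix (Fin d) (Fin d) ℂ) :
    Uᴴ * dissipator L x * U = dissipator (Uᴴ * L * U) (Uᴴ * x * U) := by
  simp only [dissipator, Matrix.mul_smul, Matrix.smul_mul, Matrix.mul_sub, Matrix.sub_mul,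
    Matrix.mul_add, Matrix.add_mul]
  simp only [conj_mul3 h', conj_star]

lemma totalDissipator_conj {d m : ℕ} {U : Matrix (Fin d) (Fin d) ℂ} (h' : U * Uᴴ = 1)
    (L : Fin m → Matrix (Fin d) (Fin d) ℂ) (x : Matrix (Fin d) (Fin d) ℂ) :
    Uᴴ * totalDissipator L x * U = totalDissipator (fun j => Uᴴ * L j * U) (Uᴴ * x * U) := by
  simp only [totalDissipator, Matrix.mul_sum, Matrix.sum_mul, dissipator_conj h']

lemma hamTerm_herm {d : ℕ} {H x : Matrix (Fin d) (Fin d) ℂ} (hH : H.IsHermitian)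
    (hx : x.IsHermitian) : (hamTerm H x).IsHermitian := by
  unfold Matrix.IsHermitian
  simp only [hamTerm, Matrix.conjTranspose_smul, Matrix.conjTranspose_sub,
    Matrix.conjTranspose_mul, hH.eq, hx.eq]
  simp only [star_neg, Complex.star_def, Complex.conj_I, neg_smul, smul_sub]
  simp
  abel

lemma totalDissipator_herm {d m : ℕ} (L : Fin m → Matrix (Fin d) (Fin d) ℂ)
    {x : Matrix (Fin d) (Fin d) ℂ} (hx : x.IsHermitian) : (totalDissipator L x).IsHermitian := by
  unfold Matrix.IsHermitian
  simp only [totalDissipator, Matrix.conjTranspose_sum]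
  refine Finset.sum_congr rfl fun j _ => ?_
  simp only [dissipator, Matrix.conjTranspose_smul, Matrix.conjTranspose_sub,
    Matrix.conjTranspose_add, Matrix.conjTranspose_mul, hx.eq, Matrix.conjTranspose_conjTranspose]
  rw [add_comm (x * _)]
  simp [Matrix.mul_assoc]

lemma dissipator_diag_re {d : ℕ} (L : Matrix (Fin d) (Fin d) ℂ) (lam : Fin d → ℝ) (k : Fin d) :
    (dissipator L (Matrix.diagonal fun i => (lam i : ℂ)) k k).re
      = ∑ l, (lam l * ‖L k l‖ ^ 2 - lam k * ‖L l k‖ ^ 2) := by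
  have h1 : dissipator L (Matrix.diagonal fun i => (lam i : ℂ)) k k
      = ((∑ l, (lam l * ‖L k l‖ ^ 2 - lam k * ‖L l k‖ ^ 2) : ℝ) : ℂ) := by
    have hn : ∀ z : ℂ, ((‖z‖ : ℝ) : ℂ) ^ 2 = z * star z := by
      intro z
      rw [Complex.star_def, Complex.mul_conj, Complex.normSq_eq_norm_sq]
      push_cast; rfl
    simp only [dissipator, Matrix.sub_apply, Matrix.smul_apply, Matrix.add_apply,
      Matrix.mul_diagonal, Matrix.diagonal_mul]
    rw [Matrix.mul_apply, Matrix.mul_apply]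
    simp only [Matrix.mul_diagonal, Matrix.conjTranspose_apply]
    push_cast
    simp only [hn, Finset.sum_sub_distrib, ← Finset.mul_sum, smul_eq_mul]
    congr 1
    · refine Finset.sum_congr rfl fun l _ => by ring
    · have : ∑ l, star (L l k) * L l k = ∑ l, L l k * star (L l k) :=
        Finset.sum_congr rfl fun l _ => mul_comm _ _
      rw [this]; ring
  rw [h1, Complex.ofReal_re]

lemma hamTerm_diag {d : ℕ} (H : Matrix (Fin d) (Fin d) ℂ) (lam : Fin d → ℝ) (k l : Fin d)
    (h : lam k = lam l) : hamTerm H (Matrix.diagonal fun i => (lam i : ℂ)) k l = 0 := by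
  simp [hamTerm, Matrix.mul_diagonal, Matrix.diagonal_mul, h, mul_comm]

/-- right time-derivative of the trace-norm distance between two solutions
of the master equation. The data `(e, λ)` is a simultaneous diagonalization of
`x(t) = ρ(t) - σ(t)` and of `y(t) = P·D(x(t))·P` (with `P` the kernel projection of
`x(t)`), and `sg k` is the eigenvalue of `sgn(x(t) + y(t))` on `e k`. -/
theorem right_derivative_traceNorm {d m : ℕ}
    (L : Fin m → Matrix (Fin d) (Fin d) ℂ)
    (H : ℝ → Matrix (Fin d) (Fin d) ℂ) (hH : IsHamiltonianFamily H)
    (s : ℝ) (ρ σ : ℝ → Matrix (Fin d) (Fin d) ℂ)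
    (hρ : IsSolution (driven H L) s ρ) (hσ : IsSolution (driven H L) s σ)
    (hρd : IsDensity (ρ s)) (hσd : IsDensity (σ s))
    (t : ℝ) (ht : s ≤ t)
    (e : Fin d → Fin d → ℂ) (lam : Fin d → ℝ)
    -- `e` is an orthonormal basis:
    (he : ∀ k l, star (e k) ⬝ᵥ e l = if k = l then (1 : ℂ) else 0)
    -- diagonalizing `x(t)`:
    (hx : ρ t - σ t = ∑ k, (lam k : ℂ) • Matrix.vecMulVec (e k) (star (e k)))
    -- `y(t) = P · D(x(t)) · P`:
    (y : Matrix (Fin d) (Fin d) ℂ)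
    (hy : y = kerProj e lam * totalDissipator L (ρ t - σ t) * kerProj e lam)
    -- the basis also diagonalizes `y(t)`:
    (hydiag : ∀ k l, k ≠ l → star (e l) ⬝ᵥ (y *ᵥ e k) = 0)
    -- `sg k` is the eigenvalue of `sgn(x(t) + y(t))` on `e k`:
    (sg : Fin d → ℝ)
    (hsg : ∀ k, sg k = Real.sign (lam k + (star (e k) ⬝ᵥ (y *ᵥ e k)).re)) :
    HasDerivWithinAt (fun u => traceNorm (ρ u - σ u))
      (-(∑ k, ∑ l, |lam k| * (1 - sg k * sg l) *
        ∑ j, ‖star (e l) ⬝ᵥ (L j *ᵥ e k)‖ ^ 2))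
      (Set.Ioi t) t := by
  set U : Matrix (Fin d) (Fin d) ℂ := Matrix.of fun i k => e k i with hU
  have hel : ∀ (M : Matrix (Fin d) (Fin d) ℂ) k l,
      star (e k) ⬝ᵥ (M *ᵥ e l) = (Uᴴ * M * U) k l := by
    intro M k l
    rw [Matrix.mul_assoc, Matrix.mul_apply]
    rfl
  have h : Uᴴ * U = 1 := by
    ext k l
    have := hel 1 k l
    rw [Matrix.mul_one, Matrix.one_mulVec, he] at this
    rw [← this, Matrix.one_apply]
  have h' : U * Uᴴ = 1 := mul_eq_one_comm.mp h
  have hsumdiag : ∀ g : Fin d → ℂ, Uᴴ * (∑ k, g k • Matrix.vecMulVec (e k) (star (e k))) * U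
      = Matrix.diagonal g := by
    intro g
    have h1 : (∑ k, g k • Matrix.vecMulVec (e k) (star (e k))) = U * Matrix.diagonal g * Uᴴ := by
      ext i j
      rw [Matrix.mul_apply, Matrix.sum_apply]
      refine Finset.sum_congr rfl fun k _ => ?_
      simp [Matrix.mul_diagonal, hU, Matrix.vecMulVec_apply]
      ring
    rw [h1]
    calc _ = (Uᴴ * U) * Matrix.diagonal g * (Uᴴ * U) := by simp only [Matrix.mul_assoc]
      _ = _ := by rw [h]; simp
  have hxd : Uᴴ * (ρ t - σ t) * U = Matrix.diagonal fun k => (lam k : ℂ) := by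
    rw [hx]; exact hsumdiag _
  have hP : Uᴴ * kerProj e lam * U = Matrix.diagonal fun k => if lam k = 0 then (1 : ℂ) else 0 := by
    rw [← hsumdiag, kerProj]
    congr 3
    funext k
    split_ifs <;> simp
  set Λ : Matrix (Fin d) (Fin d) ℂ := Matrix.diagonal fun k => (lam k : ℂ) with hΛ
  set M := fun j => Uᴴ * L j * U with hM
  have hyd : ∀ k l, star (e k) ⬝ᵥ (y *ᵥ e l) = if lam k = 0 ∧ lam l = 0 then
      totalDissipator M Λ k l else 0 := by
    intro k l
    rw [hel, hy, conj_mul3 h', conj_mul3 h', hP, totalDissipator_conj h', hxd,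
      Matrix.mul_diagonal, Matrix.diagonal_mul]
    by_cases h1 : lam k = 0 <;> by_cases h2 : lam l = 0 <;> simp [h1, h2, hM]
  set B := hamTerm (Uᴴ * H t * U) Λ + totalDissipator M Λ with hBdef
  have hΛh : Λ.IsHermitian := by
    rw [hΛ, Matrix.isHermitian_diagonal_iff]
    intro i
    exact Complex.conj_ofReal _
  have hBU : Uᴴ * driven H L t (ρ t - σ t) * U = B := by
    rw [driven, Matrix.mul_add, Matrix.add_mul, hamTerm_conj h', totalDissipator_conj h', hxd]
  have hBh : B.IsHermitian := by
    refine (hamTerm_herm ?_ hΛh).add (totalDissipator_herm _ hΛh)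
    exact Matrix.isHermitian_conjTranspose_mul_mul U (hH.1 t)
  have hBD : ∀ k l, lam k = lam l → B k l = totalDissipator M Λ k l := by
    intro k l hkl
    rw [hBdef, Matrix.add_apply, hΛ, hamTerm_diag _ _ _ _ hkl, zero_add]
  have hsg2 : ∀ k, lam k ≠ 0 → sg k = Real.sign (lam k) := by
    intro k hk
    rw [hsg, hyd]; simp [hk]
  have hsg3 : ∀ k, lam k = 0 → sg k = Real.sign (B k k).re := by
    intro k hk
    rw [hsg, hyd, hBD k k rfl]; simp [hk]
  have hsg1 : ∀ k, |sg k| ≤ 1 := by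
    intro k
    rw [hsg]
    rcases Real.sign_apply_eq (lam k + (star (e k) ⬝ᵥ (y *ᵥ e k)).re) with h | h | h <;>
      rw [h] <;> simp
  have hmain := main_diag (fun u => Uᴴ * (ρ u - σ u) * U) B t lam sg ?_ hxd hBh ?_ hsg1 hsg2 hsg3
  · have hfun : (fun u => traceNorm (Uᴴ * (ρ u - σ u) * U)) = fun u => traceNorm (ρ u - σ u) := by
      funext u
      exact traceNorm_conj h h' _
    rw [hfun] at hmain
    refine hmain.congr_deriv ?_
    simp only [hel]
    have hsl : ∀ k, lam k = |lam k| * sg k := by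
      intro k
      rcases lt_trichotomy (lam k) 0 with h | h | h
      · rw [hsg2 k h.ne, Real.sign_of_neg h, abs_of_neg h]; ring
      · simp [h]
      · rw [hsg2 k h.ne', Real.sign_of_pos h, abs_of_pos h]; ring
    have hsa : ∀ k, sg k * lam k = |lam k| := by
      intro k
      rcases lt_trichotomy (lam k) 0 with h | h | h
      · rw [hsg2 k h.ne, Real.sign_of_neg h, abs_of_neg h]; ring
      · simp [h]
      · rw [hsg2 k h.ne', Real.sign_of_pos h, abs_of_pos h]; ring
    set q : Fin d → Fin d → ℝ := fun l k => ∑ j, ‖M j l k‖ ^ 2 with hq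
    have hBk : ∀ k, (B k k).re = ∑ l, (lam l * q k l - lam k * q l k) := by
      intro k
      rw [hBD k k rfl, totalDissipator, Matrix.sum_apply, Complex.re_sum]
      simp only [hΛ, dissipator_diag_re]
      rw [Finset.sum_comm]
      refine Finset.sum_congr rfl fun l _ => ?_
      rw [Finset.sum_sub_distrib, ← Finset.mul_sum, ← Finset.mul_sum]
    calc ∑ k, sg k * (B k k).re
        = (∑ k, ∑ l, sg k * lam l * q k l) - ∑ k, ∑ l, |lam k| * q l k := by
          rw [← Finset.sum_sub_distrib]
          refine Finset.sum_congr rfl fun k _ => ?_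
          rw [hBk, Finset.mul_sum, ← Finset.sum_sub_distrib]
          refine Finset.sum_congr rfl fun l _ => ?_
          rw [← hsa k]; ring
      _ = (∑ k, ∑ l, sg l * lam k * q l k) - ∑ k, ∑ l, |lam k| * q l k := by
          rw [Finset.sum_comm]
      _ = -∑ k, ∑ l, |lam k| * (1 - sg k * sg l) * q l k := by
          rw [← Finset.sum_sub_distrib, ← Finset.sum_neg_distrib]
          refine Finset.sum_congr rfl fun k _ => ?_
          rw [← Finset.sum_sub_distrib, ← Finset.sum_neg_distrib]
          refine Finset.sum_congr rfl fun l _ => ?_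
          nth_rewrite 1 [hsl k]
          ring
  · intro i j
    have hd : ∀ a b, HasDerivAt (fun u => (ρ u - σ u) a b) (driven H L t (ρ t - σ t) a b) t := by
      intro a b
      rw [driven_sub]
      exact (hρ t ht a b).sub (hσ t ht a b)
    rw [← hBU]
    simp only [Matrix.mul_apply]
    refine HasDerivAt.fun_sum fun b _ => ?_
    refine HasDerivAt.mul_const ?_ _
    refine HasDerivAt.fun_sum fun a _ => ?_
    exact (hd a b).const_mul _
  · intro k l hkl hk hl
    rw [hBD k l (hk.trans hl.symm)]
    have := hydiag l k hkl.symm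
    rw [hyd] at this
    simpa [hk, hl] using this

end Paper
end
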